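/- Let 0 ≤ s < 1 and ε > 0. There exist ε' > 0 and C > 0 depending only on s and ε such that: for every N ≥ 2, every admissible low symbol m (with parameters N, s) with associated multiplier I, every t₀ ∈ ℝ, every 0 < δ ≤ 1, and all Schwartz functions u₁, u₂, u₃, u₄ : ℝ×ℝ→ℂ, one has |∫_{t₀}^{t₀+δ} Λ₄(M₄''; u₁(·,t), \overline{u₂(·,t)}, u₃(·,t), \overline{u₄(·,t)}) dt| ≤ C N^{−1+ε} ∏_{i=1}^4 ‖I uᵢ‖_{X^{1,1/2+ε'}}, where M₄''(ξ₁,ξ₂,ξ₃,ξ₄) := m(ξ₁)² − m(ξ₂)² + m(ξ₃)² − m(ξ₄)². -/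

import Mathlib

open MeasureTheory Real

noncomputable section

/-- The Fourier transform on `ℝ`: `f̂(ξ) = ∫ e^{-ixξ} f(x) dx`. -/
def ft (f : ℝ → ℂ) (ξ : ℝ) : ℂ := ∫ x : ℝ, Complex.exp (-Complex.I * x * ξ) * f x

/-- The Japanese bracket `⟨ξ⟩ = 1 + |ξ|`. -/
def jap (ξ : ℝ) : ℝ := 1 + |ξ|

/-- The Sobolev norm `‖f‖_{H^s} = (∫ ⟨ξ⟩^{2s} |f̂(ξ)|² dξ)^{1/2}`. -/
def HsNorm (s : ℝ) (f : ℝ → ℂ) : ℝ :=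
  (∫ ξ : ℝ, jap ξ ^ (2 * s) * ‖ft f ξ‖ ^ 2) ^ ((1 : ℝ) / 2)

/-- The squared `L²` norm. -/
def L2sq (f : ℝ → ℂ) : ℝ := ∫ x : ℝ, ‖f x‖ ^ 2

/-- The spacetime Fourier transform (x first variable, t second). -/
def stft (u : ℝ → ℝ → ℂ) (ξ τ : ℝ) : ℂ :=
  ∫ t : ℝ, ∫ x : ℝ, Complex.exp (-Complex.I * (x * ξ + t * τ)) * u x t

/-- The `X^{s,b}` norm. -/
def XsbNorm (s b : ℝ) (u : ℝ → ℝ → ℂ) : ℝ :=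
  (∫ ξ : ℝ, ∫ τ : ℝ,
    jap ξ ^ (2 * s) * jap (τ - ξ ^ 2) ^ (2 * b) * ‖stft u ξ τ‖ ^ 2) ^ ((1 : ℝ) / 2)

/-- The Fourier multiplier with symbol `θ`: `(mult θ f)̂(ξ) = θ(ξ) f̂(ξ)`. -/
def mult (θ : ℝ → ℝ) (f : ℝ → ℂ) (x : ℝ) : ℂ :=
  (2 * π)⁻¹ • ∫ ξ : ℝ, Complex.exp (Complex.I * x * ξ) * (θ ξ : ℂ) * ft f ξ

/-- The multiplier applied in the `x`-variable of a spacetime function. -/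
def multX (θ : ℝ → ℝ) (u : ℝ → ℝ → ℂ) (x t : ℝ) : ℂ := mult θ (fun y => u y t) x

/-- The cubic nonlinearity `F(z) = |z|² z`. -/
def Fnl (z : ℂ) : ℂ := (‖z‖ : ℂ) ^ 2 * z

/-- The real inner product `⟨f,g⟩ = Re ∫ f ḡ`. -/
def rip (f g : ℝ → ℂ) : ℝ := (∫ x : ℝ, f x * (starRingEnd ℂ) (g x)).re

/-- The Lyapunov functional `L(u) = ∫ |∂ₓu|² + |u|² - ½|u|⁴`. -/
def Lfun (f : ℝ → ℂ) : ℝ :=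
  ∫ x : ℝ, (‖deriv f x‖ ^ 2 + ‖f x‖ ^ 2
    - (1 / 2) * ‖f x‖ ^ 4)

/-- The Lyapunov functional with the `H¹`-part expressed on the Fourier side
(Plancherel form), suitable for `H¹` functions. -/
def LfunH1 (f : ℝ → ℂ) : ℝ :=
  (2 * π)⁻¹ * (∫ ξ : ℝ, (ξ ^ 2 + 1) * ‖ft f ξ‖ ^ 2)
    - (1 / 2) * ∫ x : ℝ, ‖f x‖ ^ 4

/-- Membership in `H¹(ℝ)`. -/
def MemH1 (f : ℝ → ℂ) : Prop :=
  MemLp f 2 (volume : Measure ℝ) ∧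
    Integrable (fun ξ : ℝ => jap ξ ^ (2 : ℝ) * ‖ft f ξ‖ ^ 2)

/-- The ground state `Q(x) = 2^{-1/2} / cosh x`. -/
def Qgs (x : ℝ) : ℝ := (Real.sqrt 2)⁻¹ / Real.cosh x

/-- A point `e^{iα} Q(· - x₀)` of the ground state cylinder. -/
def Qcyl (α x₀ : ℝ) (x : ℝ) : ℂ := Complex.exp (Complex.I * α) * (Qgs (x - x₀) : ℂ)

/-- The ground state cylinder `Σ`. -/
def groundCyl : Set (ℝ → ℂ) := { f | ∃ α x₀ : ℝ, f = Qcyl α x₀ }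

/-- `dist_{H^s}(f, Σ)`. -/
def distHs (s : ℝ) (f : ℝ → ℂ) : ℝ :=
  ⨅ v ∈ groundCyl, HsNorm s (fun x => f x - v x)

/-- A smooth function `u(x,t)` all of whose `x`-derivatives are rapidly decreasing
in `x`, locally uniformly in `t`. -/
structure IsSchwartzInX (u : ℝ → ℝ → ℂ) : Prop where
  smooth : ContDiff ℝ (⊤ : ℕ∞) (fun p : ℝ × ℝ => u p.1 p.2)
  decay : ∀ (k n : ℕ) (T : ℝ), 0 < T → ∃ C : ℝ, ∀ x t : ℝ, |t| ≤ T →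
    |x| ^ k * ‖iteratedDeriv n (fun y => u y t) x‖ ≤ C

/-- A smooth Schwartz solution of the focusing cubic NLS `iu_t + u_xx = -|u|²u`. -/
structure IsSchwartzSolution (u : ℝ → ℝ → ℂ) extends IsSchwartzInX u : Prop where
  eqn : ∀ x t : ℝ, Complex.I * deriv (fun τ => u x τ) t
      + iteratedDeriv 2 (fun y => u y t) x
      = -((‖u x t‖ : ℂ) ^ 2 * u x t)

/-- A Schwartz function on spacetime. -/
def IsSchwartz2 (u : ℝ → ℝ → ℂ) : Prop :=
  ∃ g : SchwartzMap (ℝ × ℝ) ℂ, ∀ x t : ℝ, u x t = g (x, t)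

/-- An admissible high symbol `θ` with parameters `N`, `s`. -/
structure AdmissibleHigh (N s : ℝ) (θ : ℝ → ℝ) : Prop where
  smooth : ContDiff ℝ (⊤ : ℕ∞) θ
  even : ∀ ξ : ℝ, θ (-ξ) = θ ξ
  eq_one : ∀ ξ : ℝ, |ξ| ≤ N → θ ξ = 1
  eq_high : ∀ ξ : ℝ, 2 * N ≤ |ξ| → θ ξ = |ξ| ^ s * N ^ (-s)
  mono : ∀ ξ η : ℝ, |ξ| ≤ |η| → θ ξ ≤ θ η
  deriv1 : ∀ ξ : ℝ, |deriv (fun ζ => θ ζ ^ 2) ξ| ≤ 10 * θ ξ ^ 2 / jap ξ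
  deriv2 : ∀ ξ : ℝ, |iteratedDeriv 2 (fun ζ => θ ζ ^ 2) ξ| ≤ 10 * θ ξ ^ 2 / jap ξ ^ 2

/-- An admissible low symbol `m` with parameters `N`, `s`. -/
structure AdmissibleLow (N s : ℝ) (m : ℝ → ℝ) : Prop where
  smooth : ContDiff ℝ (⊤ : ℕ∞) m
  even : ∀ ξ : ℝ, m (-ξ) = m ξ
  eq_one : ∀ ξ : ℝ, |ξ| ≤ N → m ξ = 1
  eq_high : ∀ ξ : ℝ, 2 * N ≤ |ξ| → m ξ = |ξ| ^ (s - 1) * N ^ (1 - s)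
  anti : ∀ ξ η : ℝ, |ξ| ≤ |η| → m η ≤ m ξ
  mono : ∀ ξ η : ℝ, |ξ| ≤ |η| → m ξ * jap ξ ≤ m η * jap η
  deriv1 : ∀ ξ : ℝ, |deriv m ξ| ≤ 10 * m ξ / jap ξ
  deriv2 : ∀ ξ : ℝ, |iteratedDeriv 2 m ξ| ≤ 10 * m ξ / jap ξ ^ 2

/-- The multilinear form `Λ₄` on the hyperplane `ξ₁+ξ₂+ξ₃+ξ₄ = 0`. -/
def Lam4 (M : ℝ → ℝ → ℝ → ℝ → ℝ) (f₁ f₂ f₃ f₄ : ℝ → ℂ) : ℂ :=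
  ∫ ξ₁ : ℝ, ∫ ξ₂ : ℝ, ∫ ξ₃ : ℝ,
    (M ξ₁ ξ₂ ξ₃ (-(ξ₁ + ξ₂ + ξ₃)) : ℂ) * ft f₁ ξ₁ * ft f₂ ξ₂ * ft f₃ ξ₃
      * ft f₄ (-(ξ₁ + ξ₂ + ξ₃))

/-- The multilinear form `Λ₆` on the hyperplane `ξ₁+⋯+ξ₆ = 0`. -/
def Lam6 (M : ℝ → ℝ → ℝ → ℝ → ℝ → ℝ → ℝ) (f₁ f₂ f₃ f₄ f₅ f₆ : ℝ → ℂ) : ℂ :=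
  ∫ ξ₁ : ℝ, ∫ ξ₂ : ℝ, ∫ ξ₃ : ℝ, ∫ ξ₄ : ℝ, ∫ ξ₅ : ℝ,
    (M ξ₁ ξ₂ ξ₃ ξ₄ ξ₅ (-(ξ₁ + ξ₂ + ξ₃ + ξ₄ + ξ₅)) : ℂ) * ft f₁ ξ₁ * ft f₂ ξ₂
      * ft f₃ ξ₃ * ft f₄ ξ₄ * ft f₅ ξ₅ * ft f₆ (-(ξ₁ + ξ₂ + ξ₃ + ξ₄ + ξ₅))

/-- The complex conjugate of a function. -/
def cj (f : ℝ → ℂ) : ℝ → ℂ := fun x => (starRingEnd ℂ) (f x)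

open scoped ENNReal

/-- The time-cutoff kernel bound. -/
def timeKernel (y : ℝ) : ℝ≥0∞ := ENNReal.ofReal (3 / (1 + |y|))

lemma measurable_timeKernel : Measurable timeKernel := by
  unfold timeKernel
  fun_prop

lemma integrableOn_abs_rpow_neg_half :
    IntegrableOn (fun r : ℝ => |r| ^ (-(1 / 2) : ℝ)) (Set.Icc (-1) 1) := by
  have h1 : IntervalIntegrable (fun r : ℝ => |r| ^ (-(1 / 2) : ℝ)) volume 0 1 := by
    refine (intervalIntegral.intervalIntegrable_rpow' (a := 0) (b := 1) (r := -(1 / 2))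
      (by norm_num)).congr ?_
    intro x hx
    rw [Set.uIoc_of_le zero_le_one] at hx
    simp [abs_of_pos hx.1]
  have h2 : IntervalIntegrable (fun r : ℝ => |r| ^ (-(1 / 2) : ℝ)) volume (-1) 0 := by
    have := (IntervalIntegrable.iff_comp_neg (f := fun r : ℝ => |r| ^ (-(1 / 2) : ℝ))
      (a := 0) (b := 1)).1 h1
    simpa using this.symm
  have := h2.trans h1
  rwa [intervalIntegrable_iff_integrableOn_Icc_of_le (by norm_num)] at this

lemma timeKernel_weight_pointwise (a r : ℝ) :
    3 / (1 + |2 * r + a|) * |r| ^ (-(1 / 2) : ℝ) ≤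
      (Set.Icc (-1 : ℝ) 1).indicator (fun r => 3 * |r| ^ (-(1 / 2) : ℝ)) r
        + 6 * ((1 + ‖r + a / 2‖) ^ (-(3 / 2) : ℝ) + (1 + ‖r‖) ^ (-(3 / 2) : ℝ)) := by
  have hX : 3 / (1 + |2 * r + a|) ≤ 3 * (1 + ‖r + a / 2‖) ^ (-1 : ℝ) := by
    rw [Real.rpow_neg_one, ← div_eq_mul_inv]
    have : |2 * r + a| = 2 * |r + a / 2| := by
      rw [← abs_two, ← abs_mul, abs_two]; ring_nf
    rw [this, Real.norm_eq_abs]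
    have := abs_nonneg (r + a / 2)
    gcongr
    linarith
  set X := 1 + ‖r + a / 2‖ with hXd
  set Y := 1 + ‖r‖ with hYd
  have hX1 : 1 ≤ X := by rw [hXd]; linarith [norm_nonneg (r + a / 2)]
  have hY1 : 1 ≤ Y := by rw [hYd]; linarith [norm_nonneg r]
  have hpos : 0 ≤ X ^ (-(3 / 2) : ℝ) + Y ^ (-(3 / 2) : ℝ) := by positivity
  by_cases hr : r ∈ Set.Icc (-1 : ℝ) 1
  · rw [Set.indicator_of_mem hr]
    have h0 : 0 ≤ |r| ^ (-(1 / 2) : ℝ) := by positivity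
    have : 3 / (1 + |2 * r + a|) ≤ 3 := by
      rw [div_le_iff₀ (by positivity)]; linarith [abs_nonneg (2 * r + a)]
    nlinarith
  · rw [Set.indicator_of_notMem hr, zero_add]
    have hr1 : 1 ≤ |r| := by
      by_contra! h
      exact hr (abs_le.1 h.le)
    have hrY : |r| ^ (-(1 / 2) : ℝ) ≤ 2 * Y ^ (-(1 / 2) : ℝ) := by
      have h1 : Y / 4 ≤ |r| := by rw [hYd, Real.norm_eq_abs]; linarith
      calc |r| ^ (-(1 / 2) : ℝ) ≤ (Y / 4) ^ (-(1 / 2) : ℝ) :=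
            Real.rpow_le_rpow_of_nonpos (by positivity) h1 (by norm_num)
        _ = 2 * Y ^ (-(1 / 2) : ℝ) := by
            rw [Real.div_rpow (by positivity) (by norm_num)]
            have : (4 : ℝ) ^ (-(1 / 2) : ℝ) = 1 / 2 := by
              rw [show (4 : ℝ) = 2 ^ (2 : ℝ) by norm_num, ← Real.rpow_mul (by norm_num)]
              norm_num [Real.rpow_neg_one]
            rw [this]; ring
    have hXY : X ^ (-1 : ℝ) * Y ^ (-(1 / 2) : ℝ) ≤ X ^ (-(3 / 2) : ℝ) + Y ^ (-(3 / 2) : ℝ) := by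
      rcases le_total X Y with h | h
      · calc X ^ (-1 : ℝ) * Y ^ (-(1 / 2) : ℝ) ≤ X ^ (-1 : ℝ) * X ^ (-(1 / 2) : ℝ) :=
              mul_le_mul_of_nonneg_left
                (Real.rpow_le_rpow_of_nonpos (by positivity) h (by norm_num)) (by positivity)
          _ = X ^ (-(3 / 2) : ℝ) := by rw [← Real.rpow_add (by positivity)]; norm_num
          _ ≤ _ := by linarith [show 0 ≤ Y ^ (-(3 / 2) : ℝ) by positivity]
      · calc X ^ (-1 : ℝ) * Y ^ (-(1 / 2) : ℝ) ≤ Y ^ (-1 : ℝ) * Y ^ (-(1 / 2) : ℝ) :=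
              mul_le_mul_of_nonneg_right
                (Real.rpow_le_rpow_of_nonpos (by positivity) h (by norm_num)) (by positivity)
          _ = Y ^ (-(3 / 2) : ℝ) := by rw [← Real.rpow_add (by positivity)]; norm_num
          _ ≤ _ := by linarith [show 0 ≤ X ^ (-(3 / 2) : ℝ) by positivity]
    calc 3 / (1 + |2 * r + a|) * |r| ^ (-(1 / 2) : ℝ)
        ≤ 3 * X ^ (-1 : ℝ) * (2 * Y ^ (-(1 / 2) : ℝ)) := by gcongr
      _ = 6 * (X ^ (-1 : ℝ) * Y ^ (-(1 / 2) : ℝ)) := by ring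
      _ ≤ _ := by gcongr

lemma exists_timeKernel_weight_bound :
    ∃ C : ℝ≥0∞, C ≠ ∞ ∧ ∀ a : ℝ,
      ∫⁻ r : ℝ, timeKernel (2 * r + a) * ENNReal.ofReal (|r| ^ (-(1 / 2) : ℝ)) ≤ C := by
  set J : ℝ≥0∞ := ∫⁻ r : ℝ, ENNReal.ofReal ((1 + ‖r‖) ^ (-(3 / 2) : ℝ)) with hJ
  have hJt : J < ∞ := finite_integral_one_add_norm (by norm_num)
  set L : ℝ≥0∞ := ∫⁻ r : ℝ, ENNReal.ofReal
    ((Set.Icc (-1 : ℝ) 1).indicator (fun r => 3 * |r| ^ (-(1 / 2) : ℝ)) r) with hL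
  have hLt : L < ∞ := by
    have : Integrable ((Set.Icc (-1 : ℝ) 1).indicator (fun r => 3 * |r| ^ (-(1 / 2) : ℝ))) :=
      (integrable_indicator_iff measurableSet_Icc).2 (integrableOn_abs_rpow_neg_half.const_mul 3)
    exact this.lintegral_lt_top
  refine ⟨L + 6 * (J + J), ?_, fun a => ?_⟩
  · exact ENNReal.add_ne_top.2 ⟨hLt.ne, ENNReal.mul_ne_top (by norm_num)
      (ENNReal.add_ne_top.2 ⟨hJt.ne, hJt.ne⟩)⟩
  have hm : Measurable fun r : ℝ => ENNReal.ofReal ((1 + ‖r‖) ^ (-(3 / 2) : ℝ)) := by fun_prop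
  have hm' : Measurable fun r : ℝ => ENNReal.ofReal ((1 + ‖r + a / 2‖) ^ (-(3 / 2) : ℝ)) := by
    fun_prop
  calc ∫⁻ r : ℝ, timeKernel (2 * r + a) * ENNReal.ofReal (|r| ^ (-(1 / 2) : ℝ))
      ≤ ∫⁻ r : ℝ, (ENNReal.ofReal
          ((Set.Icc (-1 : ℝ) 1).indicator (fun r => 3 * |r| ^ (-(1 / 2) : ℝ)) r)
          + 6 * (ENNReal.ofReal ((1 + ‖r + a / 2‖) ^ (-(3 / 2) : ℝ))
            + ENNReal.ofReal ((1 + ‖r‖) ^ (-(3 / 2) : ℝ)))) := by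
        refine lintegral_mono fun r => ?_
        rw [timeKernel, ← ENNReal.ofReal_mul (by positivity)]
        refine (ENNReal.ofReal_le_ofReal (timeKernel_weight_pointwise a r)).trans_eq ?_
        rw [ENNReal.ofReal_add, ENNReal.ofReal_mul (by norm_num), ENNReal.ofReal_add]
        · norm_num
        · positivity
        · positivity
        · exact Set.indicator_nonneg (fun _ _ => by positivity) _
        · positivity
    _ = L + 6 * (J + J) := by
        rw [lintegral_add_right _ (by fun_prop), lintegral_const_mul _ (by fun_prop),
          lintegral_add_right _ hm,
          lintegral_add_right_eq_self (fun r : ℝ => ENNReal.ofReal ((1 + ‖r‖) ^ (-(3 / 2) : ℝ)))]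

lemma lintegral_comp_mul_left_real {p : ℝ} (hp : p ≠ 0) {f : ℝ → ℝ≥0∞} (hf : Measurable f) :
    ∫⁻ q : ℝ, f (p * q) = ENNReal.ofReal |p⁻¹| * ∫⁻ r : ℝ, f r := by
  rw [← lintegral_map hf (measurable_const_mul p), Real.map_volume_mul_left hp,
    lintegral_smul_measure, smul_eq_mul]

lemma timeKernel_weight_scaled {C : ℝ≥0∞}
    (hC : ∀ a : ℝ,
      ∫⁻ r : ℝ, timeKernel (2 * r + a) * ENNReal.ofReal (|r| ^ (-(1 / 2) : ℝ)) ≤ C)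
    (a p : ℝ) (hp : p ≠ 0) :
    ∫⁻ q : ℝ, timeKernel (2 * (p * q) + a)
      * ENNReal.ofReal (|p| ^ (1 / 2 : ℝ) * |q| ^ (-(1 / 2) : ℝ)) ≤ C := by
  have hp' : 0 < |p| := abs_pos.2 hp
  have key : ∀ q : ℝ, timeKernel (2 * (p * q) + a)
      * ENNReal.ofReal (|p| ^ (1 / 2 : ℝ) * |q| ^ (-(1 / 2) : ℝ))
      = ENNReal.ofReal |p| * (timeKernel (2 * (p * q) + a)
        * ENNReal.ofReal (|p * q| ^ (-(1 / 2) : ℝ))) := by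
    intro q
    rw [mul_left_comm (ENNReal.ofReal |p|), ← ENNReal.ofReal_mul hp'.le, abs_mul,
      Real.mul_rpow (abs_nonneg p) (abs_nonneg q), ← mul_assoc |p|]
    have : |p| * |p| ^ (-(1 / 2) : ℝ) = |p| ^ (1 / 2 : ℝ) := by
      rw [← Real.rpow_one_add' hp'.le (by norm_num)]
      norm_num
    rw [this]
  simp_rw [key]
  have hm : Measurable fun r : ℝ =>
      timeKernel (2 * r + a) * ENNReal.ofReal (|r| ^ (-(1 / 2) : ℝ)) :=
    (measurable_timeKernel.comp (by fun_prop)).mul (by fun_prop)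
  rw [lintegral_const_mul _ (by exact hm.comp (measurable_const_mul p)),
    lintegral_comp_mul_left_real hp hm, ← mul_assoc, ← ENNReal.ofReal_mul hp'.le, abs_inv,
    mul_inv_cancel₀ hp'.ne']
  simpa using hC a

/-- The square of the `L²` seminorm, as an extended nonnegative real, to the power `1/2`. -/
def eL2 (f : ℝ → ℝ≥0∞) : ℝ≥0∞ := (∫⁻ x, f x ^ 2) ^ (1 / 2 : ℝ)

lemma lintegral_mul_le_sqrt_mul_sqrt {α : Type*} [MeasurableSpace α] (μ : Measure α)
    {f g : α → ℝ≥0∞} (hf : Measurable f) (hg : Measurable g) :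
    ∫⁻ x, f x * g x ∂μ ≤ (∫⁻ x, f x ^ 2 ∂μ) ^ (1 / 2 : ℝ) * (∫⁻ x, g x ^ 2 ∂μ) ^ (1 / 2 : ℝ) := by
  have := ENNReal.lintegral_mul_le_Lp_mul_Lq μ Real.HolderConjugate.two_two
    hf.aemeasurable hg.aemeasurable
  simpa using this

/-- The quadrilinear form obtained by integrating over parallelograms with sides `p`, `q`. -/
def parallelogram (f₁ f₂ f₃ f₄ : ℝ → ℝ≥0∞) (p q : ℝ) : ℝ≥0∞ :=
  ∫⁻ x, f₁ x * f₂ (x - p) * f₃ (x - p - q) * f₄ (x - q)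

lemma parallelogram_swap (f₁ f₂ f₃ f₄ : ℝ → ℝ≥0∞) (p q : ℝ) :
    parallelogram f₁ f₂ f₃ f₄ p q = parallelogram f₁ f₄ f₃ f₂ q p := by
  unfold parallelogram
  refine lintegral_congr fun x => ?_
  rw [show x - p - q = x - q - p by ring]
  ring

lemma measurable_parallelogram {f₁ f₂ f₃ f₄ : ℝ → ℝ≥0∞} (h₁ : Measurable f₁) (h₂ : Measurable f₂)
    (h₃ : Measurable f₃) (h₄ : Measurable f₄) :
    Measurable (Function.uncurry (parallelogram f₁ f₂ f₃ f₄)) := by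
  unfold parallelogram
  refine Measurable.lintegral_prod_right' (f := fun z : (ℝ × ℝ) × ℝ =>
    f₁ z.2 * f₂ (z.2 - z.1.1) * f₃ (z.2 - z.1.1 - z.1.2) * f₄ (z.2 - z.1.2)) ?_
  fun_prop

/-- The correlation of the squares of two functions. -/
def sqCorr (f g : ℝ → ℝ≥0∞) (p : ℝ) : ℝ≥0∞ := ∫⁻ x, f x ^ 2 * g (x - p) ^ 2

lemma measurable_sqCorr {f g : ℝ → ℝ≥0∞} (hf : Measurable f) (hg : Measurable g) :
    Measurable (sqCorr f g) := by
  unfold sqCorr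
  refine Measurable.lintegral_prod_right' (f := fun z : ℝ × ℝ => f z.2 ^ 2 * g (z.2 - z.1) ^ 2) ?_
  fun_prop

lemma lintegral_sqCorr {f g : ℝ → ℝ≥0∞} (hf : Measurable f) (hg : Measurable g) :
    ∫⁻ p, sqCorr f g p = (∫⁻ x, f x ^ 2) * ∫⁻ x, g x ^ 2 := by
  unfold sqCorr
  rw [lintegral_lintegral_swap (by fun_prop)]
  rw [← lintegral_mul_const _ (by fun_prop)]
  refine lintegral_congr fun x => ?_
  rw [lintegral_const_mul _ (by fun_prop), lintegral_sub_left_eq_self (fun y => g y ^ 2)]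

lemma parallelogram_le {f₁ f₂ f₃ f₄ : ℝ → ℝ≥0∞} (h₁ : Measurable f₁) (h₂ : Measurable f₂)
    (h₃ : Measurable f₃) (h₄ : Measurable f₄) (p q : ℝ) :
    parallelogram f₁ f₂ f₃ f₄ p q ≤
      sqCorr f₁ f₂ p ^ (1 / 2 : ℝ) * sqCorr f₄ f₃ p ^ (1 / 2 : ℝ) := by
  have := lintegral_mul_le_sqrt_mul_sqrt volume (f := fun x => f₁ x * f₂ (x - p))
    (g := fun x => f₄ (x - q) * f₃ (x - q - p)) (by fun_prop) (by fun_prop)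
  convert this using 2
  · unfold parallelogram
    refine lintegral_congr fun x => ?_
    rw [show x - p - q = x - q - p by ring]
    ring
  · simp only [sqCorr, mul_pow]
  · simp only [sqCorr, mul_pow]
    rw [lintegral_sub_right_eq_self (fun y => f₄ y ^ 2 * f₃ (y - p) ^ 2)]

lemma lintegral_sqCorr_mul_le {f₁ f₂ f₃ f₄ : ℝ → ℝ≥0∞} (h₁ : Measurable f₁) (h₂ : Measurable f₂)
    (h₃ : Measurable f₃) (h₄ : Measurable f₄) :
    ∫⁻ p, sqCorr f₁ f₂ p ^ (1 / 2 : ℝ) * sqCorr f₄ f₃ p ^ (1 / 2 : ℝ) ≤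
      eL2 f₁ * eL2 f₂ * eL2 f₃ * eL2 f₄ := by
  have hsq : ∀ x : ℝ≥0∞, (x ^ (1 / 2 : ℝ)) ^ 2 = x := fun x => by
    rw [← ENNReal.rpow_mul_natCast]; simp
  refine (lintegral_mul_le_sqrt_mul_sqrt volume ((measurable_sqCorr h₁ h₂).pow_const _)
    ((measurable_sqCorr h₄ h₃).pow_const _)).trans_eq ?_
  simp only [hsq]
  rw [lintegral_sqCorr h₁ h₂, lintegral_sqCorr h₄ h₃,
    ENNReal.mul_rpow_of_nonneg _ _ (by norm_num), ENNReal.mul_rpow_of_nonneg _ _ (by norm_num)]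
  unfold eL2
  ring

/-- The weight `(|p| / |q|)^{1/2}`. -/
def ratioWeight (p q : ℝ) : ℝ≥0∞ := ENNReal.ofReal (|p| ^ (1 / 2 : ℝ) * |q| ^ (-(1 / 2) : ℝ))

lemma measurable_ratioWeight : Measurable (Function.uncurry ratioWeight) := by
  unfold ratioWeight Function.uncurry
  fun_prop

lemma one_le_ratioWeight_add {p q : ℝ} (hp : p ≠ 0) (hq : q ≠ 0) :
    1 ≤ ratioWeight p q + ratioWeight q p := by
  wlog h : |q| ≤ |p| generalizing p q
  · rw [add_comm]; exact this hq hp (not_le.1 h).le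
  refine le_add_right ?_
  unfold ratioWeight
  rw [ENNReal.one_le_ofReal]
  have hq' : 0 < |q| := abs_pos.2 hq
  calc (1 : ℝ) = |q| ^ (1 / 2 : ℝ) * |q| ^ (-(1 / 2) : ℝ) := by
        rw [← Real.rpow_add hq']; norm_num
    _ ≤ _ := by gcongr

lemma weighted_parallelogram_le {C : ℝ≥0∞}
    (hC : ∀ a : ℝ,
      ∫⁻ r : ℝ, timeKernel (2 * r + a) * ENNReal.ofReal (|r| ^ (-(1 / 2) : ℝ)) ≤ C)
    {f₁ f₂ f₃ f₄ : ℝ → ℝ≥0∞} (h₁ : Measurable f₁) (h₂ : Measurable f₂)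
    (h₃ : Measurable f₃) (h₄ : Measurable f₄) (a : ℝ) :
    ∫⁻ p, ∫⁻ q, timeKernel (2 * (p * q) + a) * ratioWeight p q * parallelogram f₁ f₂ f₃ f₄ p q
      ≤ C * (eL2 f₁ * eL2 f₂ * eL2 f₃ * eL2 f₄) := by
  have hk := measurable_timeKernel
  have hw := measurable_ratioWeight
  calc ∫⁻ p, ∫⁻ q, timeKernel (2 * (p * q) + a) * ratioWeight p q
        * parallelogram f₁ f₂ f₃ f₄ p q
      ≤ ∫⁻ p, C * (sqCorr f₁ f₂ p ^ (1 / 2 : ℝ) * sqCorr f₄ f₃ p ^ (1 / 2 : ℝ)) := by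
        refine lintegral_mono_ae ?_
        filter_upwards [Measure.ae_ne volume (0 : ℝ)] with p hp
        calc ∫⁻ q, timeKernel (2 * (p * q) + a) * ratioWeight p q
              * parallelogram f₁ f₂ f₃ f₄ p q
            ≤ ∫⁻ q, timeKernel (2 * (p * q) + a) * ratioWeight p q
              * (sqCorr f₁ f₂ p ^ (1 / 2 : ℝ) * sqCorr f₄ f₃ p ^ (1 / 2 : ℝ)) := by
              gcongr
              exact parallelogram_le h₁ h₂ h₃ h₄ _ _
          _ = (∫⁻ q, timeKernel (2 * (p * q) + a) * ratioWeight p q)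
              * (sqCorr f₁ f₂ p ^ (1 / 2 : ℝ) * sqCorr f₄ f₃ p ^ (1 / 2 : ℝ)) := by
              refine lintegral_mul_const _ ?_
              unfold ratioWeight
              fun_prop
          _ ≤ _ := by
              gcongr
              exact timeKernel_weight_scaled hC a p hp
    _ = C * ∫⁻ p, sqCorr f₁ f₂ p ^ (1 / 2 : ℝ) * sqCorr f₄ f₃ p ^ (1 / 2 : ℝ) :=
        lintegral_const_mul _ (((measurable_sqCorr h₁ h₂).pow_const _).mul
          ((measurable_sqCorr h₄ h₃).pow_const _))
    _ ≤ _ := by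
        gcongr
        exact lintegral_sqCorr_mul_le h₁ h₂ h₃ h₄

lemma timeKernel_parallelogram_le {C : ℝ≥0∞}
    (hC : ∀ a : ℝ,
      ∫⁻ r : ℝ, timeKernel (2 * r + a) * ENNReal.ofReal (|r| ^ (-(1 / 2) : ℝ)) ≤ C)
    {f₁ f₂ f₃ f₄ : ℝ → ℝ≥0∞} (h₁ : Measurable f₁) (h₂ : Measurable f₂)
    (h₃ : Measurable f₃) (h₄ : Measurable f₄) (a : ℝ) :
    ∫⁻ p, ∫⁻ q, timeKernel (2 * (p * q) + a) * parallelogram f₁ f₂ f₃ f₄ p q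
      ≤ 2 * C * (eL2 f₁ * eL2 f₂ * eL2 f₃ * eL2 f₄) := by
  have hk := measurable_timeKernel
  have hw := measurable_ratioWeight
  have hP := measurable_parallelogram h₁ h₂ h₃ h₄
  have hm : Measurable (Function.uncurry fun p q => timeKernel (2 * (p * q) + a) * ratioWeight p q
      * parallelogram f₁ f₂ f₃ f₄ p q) :=
    ((hk.comp (by fun_prop : Measurable fun z : ℝ × ℝ => 2 * (z.1 * z.2) + a)).mul hw).mul hP
  have hm' : Measurable (Function.uncurry fun p q => timeKernel (2 * (p * q) + a) * ratioWeight q p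
      * parallelogram f₁ f₂ f₃ f₄ p q) :=
    ((hk.comp (by fun_prop : Measurable fun z : ℝ × ℝ => 2 * (z.1 * z.2) + a)).mul
      (hw.comp measurable_swap)).mul hP
  calc ∫⁻ p, ∫⁻ q, timeKernel (2 * (p * q) + a) * parallelogram f₁ f₂ f₃ f₄ p q
      ≤ ∫⁻ p, ∫⁻ q, (timeKernel (2 * (p * q) + a) * ratioWeight p q
            * parallelogram f₁ f₂ f₃ f₄ p q
          + timeKernel (2 * (p * q) + a) * ratioWeight q p
            * parallelogram f₁ f₂ f₃ f₄ p q) := by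
        refine lintegral_mono_ae ?_
        filter_upwards [Measure.ae_ne volume (0 : ℝ)] with p hp
        refine lintegral_mono_ae ?_
        filter_upwards [Measure.ae_ne volume (0 : ℝ)] with q hq
        rw [← add_mul, ← mul_add]
        gcongr
        exact le_mul_of_one_le_right' (one_le_ratioWeight_add hp hq)
    _ = (∫⁻ p, ∫⁻ q, timeKernel (2 * (p * q) + a) * ratioWeight p q
            * parallelogram f₁ f₂ f₃ f₄ p q)
          + ∫⁻ p, ∫⁻ q, timeKernel (2 * (p * q) + a) * ratioWeight q p
            * parallelogram f₁ f₂ f₃ f₄ p q := by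
        rw [← lintegral_add_left hm.lintegral_prod_right]
        refine lintegral_congr fun p => ?_
        exact lintegral_add_left (hm.comp measurable_prodMk_left) _
    _ ≤ C * (eL2 f₁ * eL2 f₂ * eL2 f₃ * eL2 f₄) + C * (eL2 f₁ * eL2 f₄ * eL2 f₃ * eL2 f₂) := by
        refine add_le_add (weighted_parallelogram_le hC h₁ h₂ h₃ h₄ a) ?_
        rw [lintegral_lintegral_swap hm'.aemeasurable]
        simp_rw [parallelogram_swap f₁ f₂ f₃ f₄, mul_comm _ (_ : ℝ)]
        refine le_trans (le_of_eq ?_) (weighted_parallelogram_le hC h₁ h₄ h₃ h₂ a)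
        simp_rw [mul_comm (2 : ℝ)]
    _ = _ := by ring

lemma jap_pos (ξ : ℝ) : 0 < jap ξ := by unfold jap; positivity

lemma one_le_jap (ξ : ℝ) : 1 ≤ jap ξ := by unfold jap; linarith [abs_nonneg ξ]

lemma jap_neg (ξ : ℝ) : jap (-ξ) = jap ξ := by simp [jap]

lemma continuous_jap : Continuous jap := by unfold jap; fun_prop

namespace AdmissibleLow

variable {N s : ℝ} {m : ℝ → ℝ}

lemma apply_zero (hm : AdmissibleLow N s m) (hN : 0 ≤ N) : m 0 = 1 :=
  hm.eq_one 0 (by simpa using hN)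

lemma one_le_mul_jap (hm : AdmissibleLow N s m) (hN : 0 ≤ N) (ξ : ℝ) : 1 ≤ m ξ * jap ξ := by
  have := hm.mono 0 ξ (by simp)
  simpa [hm.apply_zero hN, jap] using this

lemma pos (hm : AdmissibleLow N s m) (hN : 0 ≤ N) (ξ : ℝ) : 0 < m ξ :=
  pos_of_mul_pos_left (zero_lt_one.trans_le (hm.one_le_mul_jap hN ξ)) (jap_pos ξ).le

lemma le_one (hm : AdmissibleLow N s m) (hN : 0 ≤ N) (ξ : ℝ) : m ξ ≤ 1 :=
  hm.apply_zero hN ▸ hm.anti 0 ξ (by simp)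

lemma third_le_mul_jap (hm : AdmissibleLow N s m) (hN : 0 ≤ N) {ξ : ℝ} (hξ : N / 3 ≤ |ξ|) :
    N / 3 ≤ m ξ * jap ξ := by
  have h3 : |N / 3| = N / 3 := abs_of_nonneg (by positivity)
  have := hm.mono (N / 3) ξ (h3.trans_le hξ)
  rw [hm.eq_one (N / 3) (by rw [h3]; linarith), one_mul, jap, h3] at this
  linarith

/-- The alternating sum of `m²` vanishes at low frequency, and otherwise two frequencies
are comparable to or larger than `N`. -/
lemma abs_alternating_sq_le (hm : AdmissibleLow N s m) (hN : 0 < N) {ξ₁ ξ₂ ξ₃ ξ₄ : ℝ}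
    (hsum : ξ₁ + ξ₂ + ξ₃ + ξ₄ = 0) :
    |m ξ₁ ^ 2 - m ξ₂ ^ 2 + m ξ₃ ^ 2 - m ξ₄ ^ 2| ≤
      18 / N ^ 2 * ((m ξ₁ * jap ξ₁) * (m ξ₂ * jap ξ₂) * (m ξ₃ * jap ξ₃) * (m ξ₄ * jap ξ₄)) := by
  have h1 := hm.one_le_mul_jap hN.le
  have key : ∀ a b c d : ℝ, N < |a| → a + b + c + d = 0 →
      N ^ 2 / 9 ≤ (m a * jap a) * (m b * jap b) * (m c * jap c) * (m d * jap d) := by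
    have prod : ∀ A B C D : ℝ, N / 3 ≤ A → N / 3 ≤ B → 1 ≤ C → 1 ≤ D →
        N ^ 2 / 9 ≤ A * B * C * D := by
      intro A B C D hA hB hC hD
      have hA0 : 0 ≤ A := by linarith
      have hB0 : 0 ≤ B := by linarith
      have hC0 : 0 ≤ C := by linarith
      calc N ^ 2 / 9 = N / 3 * (N / 3) * 1 * 1 := by ring
        _ ≤ A * B * C * D := by gcongr
    intro a b c d ha hs
    have hA := hm.third_le_mul_jap hN.le (ξ := a) (by linarith)
    have habs : |a| ≤ |b| + |c| + |d| := by
      rw [show a = -(b + c + d) by linarith, abs_neg]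
      exact abs_add_three b c d
    by_cases hb : N / 3 ≤ |b|
    · exact prod _ _ _ _ hA (hm.third_le_mul_jap hN.le hb) (h1 c) (h1 d)
    by_cases hc : N / 3 ≤ |c|
    · linarith [prod _ _ _ _ hA (hm.third_le_mul_jap hN.le hc) (h1 b) (h1 d)]
    · linarith [prod _ _ _ _ hA (hm.third_le_mul_jap hN.le (ξ := d) (by linarith)) (h1 b) (h1 c)]
  by_cases hlow : |ξ₁| ≤ N ∧ |ξ₂| ≤ N ∧ |ξ₃| ≤ N ∧ |ξ₄| ≤ N
  · obtain ⟨a1, a2, a3, a4⟩ := hlow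
    have hp := fun ξ => (zero_lt_one.trans_le (h1 ξ)).le
    rw [hm.eq_one _ a1, hm.eq_one _ a2, hm.eq_one _ a3, hm.eq_one _ a4]
    norm_num
    have := jap_pos ξ₁
    have := jap_pos ξ₂
    have := jap_pos ξ₃
    have := jap_pos ξ₄
    positivity
  have hprod : N ^ 2 / 9 ≤
      (m ξ₁ * jap ξ₁) * (m ξ₂ * jap ξ₂) * (m ξ₃ * jap ξ₃) * (m ξ₄ * jap ξ₄) := by
    by_cases c1 : |ξ₁| ≤ N
    · by_cases c2 : |ξ₂| ≤ N
      · by_cases c3 : |ξ₃| ≤ N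
        · have c4 : ¬ |ξ₄| ≤ N := fun c4 => hlow ⟨c1, c2, c3, c4⟩
          linarith [key ξ₄ ξ₁ ξ₂ ξ₃ (not_le.1 c4) (by linarith)]
        · linarith [key ξ₃ ξ₁ ξ₂ ξ₄ (not_le.1 c3) (by linarith)]
      · linarith [key ξ₂ ξ₁ ξ₃ ξ₄ (not_le.1 c2) (by linarith)]
    · exact key ξ₁ ξ₂ ξ₃ ξ₄ (not_le.1 c1) hsum
  have hsq : ∀ ξ, 0 ≤ m ξ ^ 2 ∧ m ξ ^ 2 ≤ 1 := fun ξ =>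
    ⟨sq_nonneg _, pow_le_one₀ (hm.pos hN.le ξ).le (hm.le_one hN.le ξ)⟩
  have h2 : |m ξ₁ ^ 2 - m ξ₂ ^ 2 + m ξ₃ ^ 2 - m ξ₄ ^ 2| ≤ 2 := by
    rw [abs_le]
    constructor <;> linarith [(hsq ξ₁).1, (hsq ξ₁).2, (hsq ξ₂).1, (hsq ξ₂).2, (hsq ξ₃).1,
      (hsq ξ₃).2, (hsq ξ₄).1, (hsq ξ₄).2]
  calc |m ξ₁ ^ 2 - m ξ₂ ^ 2 + m ξ₃ ^ 2 - m ξ₄ ^ 2| ≤ 18 / N ^ 2 * (N ^ 2 / 9) := by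
        refine h2.trans_eq ?_
        field_simp
        norm_num
    _ ≤ _ := by gcongr

end AdmissibleLow

open FourierTransform SchwartzMap in
lemma ft_eq_fourier (f : ℝ → ℂ) (ξ : ℝ) : ft f ξ = 𝓕 f (ξ / (2 * π)) := by
  rw [Real.fourier_eq', ft]
  refine integral_congr_ae (.of_forall fun x => ?_)
  simp only [smul_eq_mul, RCLike.inner_apply, conj_trivial]
  congr 2
  push_cast
  field_simp

lemma ft_two_pi_mul (f : ℝ → ℂ) (w : ℝ) : ft f (2 * π * w) = FourierTransform.fourier f w := by
  rw [ft_eq_fourier, mul_div_cancel_left₀ _ (by positivity)]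

open FourierTransform in
lemma fourierInv_eq_integral_ft (F : ℝ → ℂ) (x : ℝ) :
    𝓕⁻ (fun w => F (2 * π * w)) x
      = (2 * π)⁻¹ • ∫ ξ : ℝ, Complex.exp (Complex.I * x * ξ) * F ξ := by
  rw [Real.fourierInv_eq']
  have h := Measure.integral_comp_mul_left
    (fun ξ : ℝ => Complex.exp (Complex.I * x * ξ) * F ξ) (2 * π)
  rw [abs_of_pos (by positivity)] at h
  rw [← h]
  refine integral_congr_ae (.of_forall fun w => ?_)
  simp only [smul_eq_mul, RCLike.inner_apply, conj_trivial]
  congr 2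
  push_cast
  ring

open FourierTransform in
/-- A function on the line with two integrable derivatives has integrable Fourier transform. -/
lemma integrable_fourier_of_contDiff_two {G : ℝ → ℂ} (hG : ContDiff ℝ 2 G)
    (hint : ∀ n : ℕ, n ≤ 2 → Integrable (iteratedDeriv n G)) : Integrable (𝓕 G) := by
  have h0 : Integrable G := by simpa using hint 0 (by norm_num)
  have h2 := Real.fourier_iteratedDeriv (f := G) (N := 2) (n := 2) hG
    (fun n hn => hint n (by exact_mod_cast hn)) le_rfl
  have hcont : Continuous (𝓕 G) := by
    exact VectorFourier.fourierIntegral_continuous Real.continuous_fourierChar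
      (by exact continuous_inner) h0
  set A := ∫ v, ‖G v‖
  set B := ∫ v, ‖iteratedDeriv 2 G v‖
  have hA : ∀ w, ‖𝓕 G w‖ ≤ A := fun w =>
    VectorFourier.norm_fourierIntegral_le_integral_norm _ _ _ G w
  have hB : ∀ w, ‖𝓕 (iteratedDeriv 2 G) w‖ ≤ B := fun w =>
    VectorFourier.norm_fourierIntegral_le_integral_norm _ _ _ _ w
  refine (integrable_inv_one_add_sq.const_mul (A + B)).mono' hcont.aestronglyMeasurable
    (.of_forall fun w => ?_)
  have hB' : (2 * π * |w|) ^ 2 * ‖𝓕 G w‖ ≤ B := by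
    have := hB w
    rw [h2] at this
    simpa [abs_of_pos pi_pos] using this
  have hw : w ^ 2 * ‖𝓕 G w‖ ≤ B := by
    refine le_trans (mul_le_mul_of_nonneg_right ?_ (norm_nonneg _)) hB'
    rw [mul_pow, sq_abs]
    have : (1 : ℝ) ≤ (2 * π) ^ 2 := by nlinarith [pi_gt_three]
    nlinarith [sq_nonneg w]
  rw [← div_eq_mul_inv, le_div_iff₀ (by positivity)]
  nlinarith [hA w]

open SchwartzMap in
lemma integrable_iteratedDeriv_schwartz (n : ℕ) (h : 𝓢(ℝ, ℂ)) :
    Integrable (iteratedDeriv n h) := by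
  induction n generalizing h with
  | zero => simpa using h.integrable
  | succ n ih =>
    rw [iteratedDeriv_succ']
    exact ih (SchwartzMap.derivCLM ℂ ℂ h)

open FourierTransform SchwartzMap in
/-- Fourier inversion for the product of a Schwartz function and a `C²` symbol with bounded
derivatives. -/
lemma fourier_fourierInv_mul_schwartz {μ : ℝ → ℝ} (hμ : ContDiff ℝ 2 μ) {K : ℝ}
    (hK : ∀ n : ℕ, n ≤ 2 → ∀ x, |iteratedDeriv n μ x| ≤ K) (h : 𝓢(ℝ, ℂ)) :
    𝓕 (𝓕⁻ fun w => (μ w : ℂ) * h w) = fun w => (μ w : ℂ) * h w := by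
  set G : ℝ → ℂ := fun w => (μ w : ℂ) * h w with hGdef
  have hμc : ContDiff ℝ 2 fun w => (μ w : ℂ) := Complex.ofRealCLM.contDiff.comp hμ
  have hhc : ContDiff ℝ 2 h := h.smooth 2
  have hG : ContDiff ℝ 2 G := hμc.mul hhc
  have hμd : ∀ n : ℕ, n ≤ 2 → ∀ x, iteratedDeriv n (fun w => (μ w : ℂ)) x
      = ((iteratedDeriv n μ x : ℝ) : ℂ) := by
    intro n hn x
    have := Complex.ofRealCLM.iteratedFDeriv_comp_left (x := x) (i := n)
      (hμ.contDiffAt) (by exact_mod_cast hn)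
    simp only [iteratedDeriv_eq_iteratedFDeriv]
    exact congrArg (fun L => L fun _ => 1) this
  have hint : ∀ n : ℕ, n ≤ 2 → Integrable (iteratedDeriv n G) := by
    intro n hn
    have hn' : (n : WithTop ℕ∞) ≤ 2 := by exact_mod_cast hn
    have heq : iteratedDeriv n G = fun x => ∑ i ∈ Finset.range (n + 1),
        (n.choose i : ℂ) * iteratedDeriv i (fun w => (μ w : ℂ)) x * iteratedDeriv (n - i) h x := by
      funext x
      exact iteratedDeriv_fun_mul (hμc.contDiffAt.of_le hn') (hhc.contDiffAt.of_le hn')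
    rw [heq]
    refine integrable_finsetSum _ fun i hi => ?_
    have hi' : i ≤ 2 := by
      have := Finset.mem_range.1 hi
      omega
    refine (integrable_iteratedDeriv_schwartz (n - i) h).bdd_mul (c := n.choose i * K) ?_
      (.of_forall fun x => ?_)
    · exact (continuous_const.mul
        (hμc.continuous_iteratedDeriv i (by exact_mod_cast hi'))).aestronglyMeasurable
    · rw [hμd i hi', norm_mul, Complex.norm_real, Real.norm_eq_abs]
      simp only [Complex.norm_natCast]
      gcongr
      exact hK i hi' x
  have h0 : Integrable G := by simpa using hint 0 (by norm_num)
  have hF := integrable_fourier_of_contDiff_two hG hint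
  exact hG.continuous.fourier_fourierInv_eq h0 hF

section SpacetimeSchwartz

open FourierTransform SchwartzMap

variable (g : 𝓢(ℝ × ℝ, ℂ))

/-- The time slice of a Schwartz function on spacetime. -/
def timeSlice (t : ℝ) : 𝓢(ℝ, ℂ) :=
  SchwartzMap.compCLM ℂ (g := fun x : ℝ => (x, t))
    (by
      have h := (ContinuousLinearMap.inl ℝ ℝ ℝ).hasTemperateGrowth.add
        (Function.HasTemperateGrowth.const ((0, t) : ℝ × ℝ))
      have he : (fun x : ℝ => (x, t)) = ⇑(ContinuousLinearMap.inl ℝ ℝ ℝ) + fun _ => (0, t) := by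
        funext x
        simp
      rw [he]
      exact h)
    ⟨1, 1, fun x => by
      have : ‖x‖ ≤ ‖(x, t)‖ := norm_fst_le (x, t)
      simp only [pow_one, one_mul]
      linarith⟩ g

lemma exists_schwartz_bound :
    ∃ K : ℝ, 0 ≤ K ∧ ∀ x t : ℝ, ‖g (x, t)‖ ≤ K * ((1 + x ^ 2)⁻¹ * (1 + t ^ 2)⁻¹) := by
  refine ⟨2 ^ 4 * ((Finset.Iic (4, 0)).sup fun m => SchwartzMap.seminorm ℂ m.1 m.2) g,
    by positivity, fun x t => ?_⟩
  have h := SchwartzMap.one_add_le_sup_seminorm_apply (𝕜 := ℂ) (m := (4, 0)) (k := 4) (n := 0)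
    le_rfl le_rfl g (x, t)
  rw [norm_iteratedFDeriv_zero] at h
  rw [← mul_inv, ← div_eq_mul_inv, le_div_iff₀ (by positivity)]
  refine le_trans ?_ h
  rw [mul_comm]
  have hx : 1 + x ^ 2 ≤ (1 + ‖(x, t)‖) ^ 2 := by
    have := norm_fst_le (x, t)
    have h2 : x ^ 2 ≤ ‖(x, t)‖ ^ 2 := by
      rw [← sq_abs x]; exact pow_le_pow_left₀ (abs_nonneg x) this 2
    nlinarith [norm_nonneg (x, t)]
  have ht : 1 + t ^ 2 ≤ (1 + ‖(x, t)‖) ^ 2 := by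
    have := norm_snd_le (x, t)
    have h2 : t ^ 2 ≤ ‖(x, t)‖ ^ 2 := by
      rw [← sq_abs t]; exact pow_le_pow_left₀ (abs_nonneg t) this 2
    nlinarith [norm_nonneg (x, t)]
  calc (1 + x ^ 2) * (1 + t ^ 2) * ‖g (x, t)‖
      ≤ (1 + ‖(x, t)‖) ^ 2 * (1 + ‖(x, t)‖) ^ 2 * ‖g (x, t)‖ := by gcongr
    _ = (1 + ‖(x, t)‖) ^ 4 * ‖g (x, t)‖ := by ring

lemma integrable_schwartz_prod : Integrable (fun z : ℝ × ℝ => g z) := g.integrable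

lemma continuous_ft_timeSlice (ξ : ℝ) : Continuous fun t => ft (fun x => g (x, t)) ξ := by
  obtain ⟨K, hK0, hK⟩ := exists_schwartz_bound g
  unfold ft
  refine continuous_of_dominated (bound := fun x => K * (1 + x ^ 2)⁻¹) ?_ ?_ ?_ ?_
  · intro t
    have : Continuous fun x : ℝ => g (x, t) := g.continuous.comp (by fun_prop)
    exact Continuous.aestronglyMeasurable (by fun_prop)
  · refine fun t => .of_forall fun x => ?_
    rw [norm_mul, Complex.norm_exp]
    have h1 : (1 + t ^ 2)⁻¹ ≤ 1 := inv_le_one_of_one_le₀ (by nlinarith)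
    have : (-Complex.I * x * ξ).re = 0 := by simp
    rw [this, Real.exp_zero, one_mul]
    refine (hK x t).trans ?_
    gcongr
    exact mul_le_of_le_one_right (by positivity) h1
  · exact integrable_inv_one_add_sq.const_mul K
  · refine .of_forall fun x => ?_
    have : Continuous fun t : ℝ => g (x, t) := g.continuous.comp (by fun_prop)
    fun_prop

lemma integrable_ft_timeSlice (ξ : ℝ) : Integrable fun t => ft (fun x => g (x, t)) ξ := by
  have h : Integrable (fun z : ℝ × ℝ => Complex.exp (-Complex.I * z.1 * ξ) * g z)
      (volume.prod volume) := by
    refine (integrable_schwartz_prod g).bdd_mul (c := 1) ?_ (.of_forall fun z => ?_)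
    · exact Continuous.aestronglyMeasurable (by fun_prop)
    · rw [Complex.norm_exp]; simp
  exact h.integral_prod_right

lemma stft_eq_fourier_ft (u : ℝ → ℝ → ℂ) (ξ τ : ℝ) :
    stft u ξ τ = 𝓕 (fun t => ft (fun x => u x t) ξ) (τ / (2 * π)) := by
  rw [← ft_eq_fourier, stft, ft]
  refine integral_congr_ae (.of_forall fun t => ?_)
  simp only [ft]
  rw [← integral_const_mul]
  refine integral_congr_ae (.of_forall fun x => ?_)
  simp only
  rw [← mul_assoc, ← Complex.exp_add]
  congr 2
  ring

/-- A Schwartz function on the product, viewed on the Euclidean product. -/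
def euclSchwartz : 𝓢(WithLp 2 (ℝ × ℝ), ℂ) :=
  SchwartzMap.compCLMOfContinuousLinearEquiv ℂ (WithLp.prodContinuousLinearEquiv 2 ℝ ℝ ℝ) g

lemma stft_eq_fourier (ξ τ : ℝ) :
    stft (fun x t => g (x, t)) ξ τ =
      𝓕 (euclSchwartz g) (WithLp.toLp 2 (ξ / (2 * π), τ / (2 * π))) := by
  have h : Integrable (fun z : ℝ × ℝ => Complex.exp (-Complex.I * (z.1 * ξ + z.2 * τ)) * g z)
      (volume.prod volume) := by
    refine (integrable_schwartz_prod g).bdd_mul (c := 1) ?_ (.of_forall fun z => ?_)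
    · exact Continuous.aestronglyMeasurable (by fun_prop)
    · rw [Complex.norm_exp]; simp
  rw [SchwartzMap.fourier_coe, Real.fourier_eq', stft]
  rw [← integral_prod_symm _ h, ← Measure.volume_eq_prod,
    ← (WithLp.volume_preserving_ofLp ℝ ℝ).integral_comp
    (MeasurableEquiv.toLp 2 (ℝ × ℝ)).symm.measurableEmbedding]
  refine integral_congr_ae (.of_forall fun v => ?_)
  simp only [smul_eq_mul, WithLp.prod_inner_apply, RCLike.inner_apply, conj_trivial]
  congr 2
  push_cast
  field_simp

lemma continuous_stft : Continuous fun z : ℝ × ℝ => stft (fun x t => g (x, t)) z.1 z.2 := by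
  simp_rw [stft_eq_fourier]
  refine (𝓕 (euclSchwartz g)).continuous.comp ?_
  fun_prop

lemma exists_stft_bound :
    ∃ K : ℝ, 0 ≤ K ∧ ∀ ξ τ : ℝ, ‖stft (fun x t => g (x, t)) ξ τ‖ ≤
      K * ((1 + ξ ^ 2)⁻¹ ^ 5 * (1 + τ ^ 2)⁻¹ ^ 2) := by
  set D := 2 ^ 14 * ((Finset.Iic (14, 0)).sup fun m => SchwartzMap.seminorm ℂ m.1 m.2)
    (𝓕 (euclSchwartz g))
  refine ⟨(2 * π) ^ 14 * D, by positivity, fun ξ τ => ?_⟩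
  set w : WithLp 2 (ℝ × ℝ) := WithLp.toLp 2 (ξ / (2 * π), τ / (2 * π)) with hw
  have h := SchwartzMap.one_add_le_sup_seminorm_apply (𝕜 := ℂ) (m := (14, 0)) (k := 14) (n := 0)
    le_rfl le_rfl (𝓕 (euclSchwartz g)) w
  rw [norm_iteratedFDeriv_zero, hw, ← stft_eq_fourier] at h
  rw [← hw] at h
  have hpi : 1 ≤ 2 * π := by linarith [pi_gt_three]
  have hsq : ‖w‖ ^ 2 = (ξ / (2 * π)) ^ 2 + (τ / (2 * π)) ^ 2 := by
    rw [WithLp.prod_norm_sq_eq_of_L2]; simp only [hw, Real.norm_eq_abs, sq_abs]; rfl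
  have hn := norm_nonneg w
  have aux : ∀ y : ℝ, (y / (2 * π)) ^ 2 ≤ ‖w‖ ^ 2 → 1 + y ^ 2 ≤ ((2 * π) * (1 + ‖w‖)) ^ 2 := by
    intro y hy
    have : y ^ 2 = (2 * π) ^ 2 * (y / (2 * π)) ^ 2 := by field_simp
    rw [mul_pow, this]
    have h2 : (1 : ℝ) ≤ (2 * π) ^ 2 := one_le_pow₀ hpi
    nlinarith
  have hx := aux ξ (by rw [hsq]; nlinarith [sq_nonneg (τ / (2 * π))])
  have ht := aux τ (by rw [hsq]; nlinarith [sq_nonneg (ξ / (2 * π))])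
  rw [inv_pow, inv_pow, ← mul_inv, ← div_eq_mul_inv, le_div_iff₀ (by positivity), mul_comm]
  calc (1 + ξ ^ 2) ^ 5 * (1 + τ ^ 2) ^ 2 * ‖stft (fun x t => g (x, t)) ξ τ‖
      ≤ (((2 * π) * (1 + ‖w‖)) ^ 2) ^ 5 * (((2 * π) * (1 + ‖w‖)) ^ 2) ^ 2
        * ‖stft (fun x t => g (x, t)) ξ τ‖ := by gcongr
    _ = (2 * π) ^ 14 * ((1 + ‖w‖) ^ 14 * ‖stft (fun x t => g (x, t)) ξ τ‖) := by ring
    _ ≤ (2 * π) ^ 14 * D := by gcongr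

lemma integrable_stft_snd (ξ : ℝ) : Integrable fun τ => stft (fun x t => g (x, t)) ξ τ := by
  obtain ⟨K, hK0, hK⟩ := exists_stft_bound g
  refine (integrable_inv_one_add_sq.const_mul K).mono'
    ((continuous_stft g).comp (by fun_prop : Continuous fun τ : ℝ => (ξ, τ))).aestronglyMeasurable
    (.of_forall fun τ => (hK ξ τ).trans ?_)
  have h1 : (1 + ξ ^ 2)⁻¹ ≤ 1 := inv_le_one_of_one_le₀ (by nlinarith)
  have h2 : (1 + τ ^ 2)⁻¹ ≤ 1 := inv_le_one_of_one_le₀ (by nlinarith)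
  gcongr
  calc (1 + ξ ^ 2)⁻¹ ^ 5 * (1 + τ ^ 2)⁻¹ ^ 2 ≤ 1 * (1 + τ ^ 2)⁻¹ := by
        gcongr
        · exact pow_le_one₀ (by positivity) h1
        · exact pow_le_of_le_one (by positivity) h2 (by norm_num)
    _ = _ := one_mul _

/-- Fourier inversion in the time variable. -/
lemma ft_timeSlice_eq_integral_stft (ξ t : ℝ) :
    ft (fun x => g (x, t)) ξ =
      (2 * π)⁻¹ • ∫ τ : ℝ, Complex.exp (Complex.I * t * τ) * stft (fun x t => g (x, t)) ξ τ := by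
  have hF : 𝓕 (fun t => ft (fun x => g (x, t)) ξ)
      = fun w => stft (fun x t => g (x, t)) ξ (2 * π * w) := by
    funext w
    rw [stft_eq_fourier_ft, mul_div_cancel_left₀ _ (by positivity)]
  have hint : Integrable (𝓕 (fun t => ft (fun x => g (x, t)) ξ)) := by
    rw [hF]
    exact (integrable_stft_snd g ξ).comp_mul_left' (by positivity)
  have := congrFun ((continuous_ft_timeSlice g ξ).fourierInv_fourier_eq
    (integrable_ft_timeSlice g ξ) hint) t
  rw [← this, hF, fourierInv_eq_integral_ft]

end SpacetimeSchwartz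

section SymbolAction

open FourierTransform SchwartzMap

lemma iteratedDeriv_comp_const_mul_abs_le {m : ℝ → ℝ} {N s : ℝ} (hm : AdmissibleLow N s m)
    (hN : 0 ≤ N) (n : ℕ) (hn : n ≤ 2) (x : ℝ) :
    |iteratedDeriv n (fun w => m (2 * π * w)) x| ≤ (2 * π) ^ 2 * 10 := by
  have hmd : ContDiff ℝ n m := hm.smooth.of_le (by exact_mod_cast le_top)
  rw [congrFun (iteratedDeriv_comp_const_mul hmd (2 * π)) x]
  have hpi : 1 ≤ 2 * π := by linarith [pi_gt_three]
  have hb : |iteratedDeriv n m (2 * π * x)| ≤ 10 := by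
    set y := 2 * π * x
    have h1 := hm.le_one hN y
    have h0 := hm.pos hN y
    have hj := one_le_jap y
    interval_cases n
    · rw [iteratedDeriv_zero, abs_of_pos h0]; linarith
    · rw [iteratedDeriv_one]
      refine (hm.deriv1 y).trans ((div_le_self (by positivity) hj).trans (by linarith))
    · refine (hm.deriv2 y).trans ((div_le_self (by positivity) (one_le_pow₀ hj)).trans (by linarith))
  rw [abs_mul, abs_of_nonneg (by positivity : (0 : ℝ) ≤ (2 * π) ^ n)]
  gcongr

/-- The Fourier multiplier of a low symbol acts on Schwartz functions as its name says. -/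
lemma ft_mult_schwartz {m : ℝ → ℝ} {N s : ℝ} (hm : AdmissibleLow N s m) (hN : 0 ≤ N)
    (f : 𝓢(ℝ, ℂ)) (ξ : ℝ) : ft (mult m f) ξ = (m ξ : ℂ) * ft f ξ := by
  have hmul : mult m f = 𝓕⁻ fun w => (m (2 * π * w) : ℂ) * (𝓕 f) w := by
    funext x
    have := fourierInv_eq_integral_ft (fun ξ => (m ξ : ℂ) * ft f ξ) x
    simp only [ft_two_pi_mul, ← SchwartzMap.fourier_coe] at this
    rw [this, mult]
    simp only [mul_assoc]
  have hμ : ContDiff ℝ 2 fun w => m (2 * π * w) :=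
    (hm.smooth.of_le (WithTop.coe_le_coe.2 le_top : ((2 : ℕ∞) : WithTop ℕ∞) ≤ _)).comp
      (contDiff_const.mul contDiff_id)
  rw [ft_eq_fourier, hmul, fourier_fourierInv_mul_schwartz hμ
    (fun n hn x => iteratedDeriv_comp_const_mul_abs_le hm hN n hn x), ft_eq_fourier,
    SchwartzMap.fourier_coe]
  have hξ : 2 * π * (ξ / (2 * π)) = ξ := by field_simp
  simp only [hξ]

lemma stft_multX {m : ℝ → ℝ} {N s : ℝ} (hm : AdmissibleLow N s m) (hN : 0 ≤ N)
    (g : 𝓢(ℝ × ℝ, ℂ)) (ξ τ : ℝ) :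
    stft (multX m fun x t => g (x, t)) ξ τ = (m ξ : ℂ) * stft (fun x t => g (x, t)) ξ τ := by
  have h : ∀ t, ft (fun x => multX m (fun x t => g (x, t)) x t) ξ
      = (m ξ : ℂ) * ft (fun x => g (x, t)) ξ := fun t => ft_mult_schwartz hm hN (timeSlice g t) ξ
  rw [stft_eq_fourier_ft, stft_eq_fourier_ft, ← ft_eq_fourier, ← ft_eq_fourier]
  simp only [h]
  rw [ft, ft, ← integral_const_mul]
  refine integral_congr_ae (.of_forall fun t => ?_)
  simp only
  ring

end SymbolAction

section WeightedNorm

open SchwartzMap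

/-- The frequency profile of `u`, weighted by `m(ξ)⟨ξ⟩` and recentred on the parabola. -/
def modProfile (m : ℝ → ℝ) (u : ℝ → ℝ → ℂ) (ξ σ : ℝ) : ℝ≥0∞ :=
  ENNReal.ofReal (m ξ * jap ξ) * ‖stft u ξ (ξ ^ 2 + σ)‖ₑ

/-- The `L²` norm of the inverse of the Japanese bracket. -/
def japInvNorm : ℝ≥0∞ := (∫⁻ σ, (ENNReal.ofReal (jap σ))⁻¹ ^ 2) ^ (1 / 2 : ℝ)

lemma japInvNorm_ne_top : japInvNorm ≠ ∞ := by
  refine ENNReal.rpow_ne_top_of_nonneg (by norm_num) ?_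
  refine ne_top_of_le_ne_top (integrable_inv_one_add_sq.lintegral_lt_top).ne
    (lintegral_mono fun σ => ?_)
  rw [← ENNReal.ofReal_inv_of_pos (jap_pos σ), ← ENNReal.ofReal_pow (inv_nonneg.2 (jap_pos σ).le)]
  refine ENNReal.ofReal_le_ofReal ?_
  rw [inv_pow]
  refine inv_anti₀ (by positivity) ?_
  rw [jap, ← sq_abs σ]
  nlinarith [abs_nonneg σ]

variable {m : ℝ → ℝ} {N s : ℝ}

lemma measurable_modProfile (hm : AdmissibleLow N s m)
    (g : 𝓢(ℝ × ℝ, ℂ)) :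
    Measurable (Function.uncurry (modProfile m fun x t => g (x, t))) := by
  unfold modProfile
  have h1 : Continuous fun z : ℝ × ℝ => m z.1 * jap z.1 :=
    (hm.smooth.continuous.comp continuous_fst).mul (continuous_jap.comp continuous_fst)
  have h2 : Continuous fun z : ℝ × ℝ => stft (fun x t => g (x, t)) z.1 (z.1 ^ 2 + z.2) :=
    (continuous_stft g).comp (by fun_prop : Continuous fun z : ℝ × ℝ => (z.1, z.1 ^ 2 + z.2))
  exact (ENNReal.measurable_ofReal.comp h1.measurable).mul h2.enorm.measurable

lemma integrable_weighted_stft_sq (hm : AdmissibleLow N s m) (hN : 0 ≤ N)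
    (g : 𝓢(ℝ × ℝ, ℂ)) :
    Integrable (fun z : ℝ × ℝ => (m z.1 * jap z.1) ^ 2 * jap (z.2 - z.1 ^ 2) ^ 2
      * ‖stft (fun x t => g (x, t)) z.1 z.2‖ ^ 2) (volume.prod volume) := by
  obtain ⟨K, hK0, hK⟩ := exists_stft_bound g
  refine ((integrable_inv_one_add_sq.mul_prod integrable_inv_one_add_sq).const_mul
    (4 * K ^ 2)).mono' ?_ (.of_forall fun z => ?_)
  · have h1 := hm.smooth.continuous
    have h2 := continuous_jap
    have h3 := continuous_stft g
    exact Continuous.aestronglyMeasurable (by fun_prop)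
  · obtain ⟨ξ, τ⟩ := z
    simp only
    rw [Real.norm_of_nonneg (by positivity)]
    have hm1 := hm.le_one hN ξ
    have hm0 := hm.pos hN ξ
    set A := 1 + ξ ^ 2 with hA
    set B := 1 + τ ^ 2 with hB
    have hA1 : 1 ≤ A := by nlinarith
    have hB1 : 1 ≤ B := by nlinarith
    have hj1 : (m ξ * jap ξ) ^ 2 ≤ 2 * A := by
      have : m ξ * jap ξ ≤ jap ξ := mul_le_of_le_one_left (jap_pos ξ).le hm1
      calc (m ξ * jap ξ) ^ 2 ≤ jap ξ ^ 2 :=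
            pow_le_pow_left₀ (mul_nonneg hm0.le (jap_pos ξ).le) this 2
        _ ≤ 2 * A := by
            rw [jap, hA, ← sq_abs ξ]
            nlinarith [sq_nonneg (1 - |ξ|)]
    have hj2 : jap (τ - ξ ^ 2) ^ 2 ≤ 2 * B * A ^ 2 := by
      have h1 : jap (τ - ξ ^ 2) ≤ (1 + |τ|) * A := by
        have := abs_sub τ (ξ ^ 2)
        rw [abs_of_nonneg (sq_nonneg ξ)] at this
        rw [jap, hA]
        nlinarith [abs_nonneg τ, sq_nonneg ξ, mul_nonneg (abs_nonneg τ) (sq_nonneg ξ)]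
      calc jap (τ - ξ ^ 2) ^ 2 ≤ ((1 + |τ|) * A) ^ 2 := pow_le_pow_left₀ (jap_pos _).le h1 2
        _ = (1 + |τ|) ^ 2 * A ^ 2 := mul_pow _ _ _
        _ ≤ 2 * B * A ^ 2 := by
            gcongr
            rw [hB, ← sq_abs τ]
            nlinarith [sq_nonneg (1 - |τ|)]
    calc (m ξ * jap ξ) ^ 2 * jap (τ - ξ ^ 2) ^ 2 * ‖stft (fun x t => g (x, t)) ξ τ‖ ^ 2
        ≤ (2 * A) * (2 * B * A ^ 2) * (K * (A⁻¹ ^ 5 * B⁻¹ ^ 2)) ^ 2 := by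
          gcongr
          exact hK ξ τ
      _ = 4 * K ^ 2 * (A⁻¹ ^ 7 * B⁻¹ ^ 3) := by
          field_simp
          ring
      _ ≤ 4 * K ^ 2 * (A⁻¹ * B⁻¹) := by
          have hA2 : A⁻¹ ≤ 1 := inv_le_one_of_one_le₀ hA1
          have hB2 : B⁻¹ ≤ 1 := inv_le_one_of_one_le₀ hB1
          gcongr
          · exact pow_le_of_le_one (by positivity) hA2 (by norm_num)
          · exact pow_le_of_le_one (by positivity) hB2 (by norm_num)

lemma ofReal_XsbNorm_multX (hm : AdmissibleLow N s m) (hN : 0 ≤ N)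
    (g : 𝓢(ℝ × ℝ, ℂ)) :
    ENNReal.ofReal (XsbNorm 1 (1 / 2 + 1 / 2) (multX m fun x t => g (x, t))) =
      (∫⁻ σ, (ENNReal.ofReal (jap σ) * eL2 fun ξ => modProfile m (fun x t => g (x, t)) ξ σ) ^ 2)
        ^ (1 / 2 : ℝ) := by
  set F : ℝ × ℝ → ℝ := fun z => (m z.1 * jap z.1) ^ 2 * jap (z.2 - z.1 ^ 2) ^ 2
      * ‖stft (fun x t => g (x, t)) z.1 z.2‖ ^ 2 with hF
  have hFi : Integrable F (volume.prod volume) := integrable_weighted_stft_sq hm hN g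
  have hF0 : ∀ z, 0 ≤ F z := fun z => by positivity
  have hX : XsbNorm 1 (1 / 2 + 1 / 2) (multX m fun x t => g (x, t))
      = (∫ z, F z ∂(volume.prod volume)) ^ (1 / 2 : ℝ) := by
    rw [integral_prod _ hFi, XsbNorm]
    congr 1
    refine integral_congr_ae (.of_forall fun ξ => integral_congr_ae (.of_forall fun τ => ?_))
    simp only [hF, stft_multX hm hN g, norm_mul, Complex.norm_real, Real.norm_eq_abs, mul_pow,
      sq_abs]
    have h2 : (2 * (1 / 2 + 1 / 2) : ℝ) = (2 : ℕ) := by norm_num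
    have h1 : (2 * 1 : ℝ) = (2 : ℕ) := by norm_num
    rw [h2, h1, Real.rpow_natCast, Real.rpow_natCast]
    ring
  rw [hX, ← ENNReal.ofReal_rpow_of_nonneg (integral_nonneg hF0) (by norm_num),
    ofReal_integral_eq_lintegral_ofReal hFi (.of_forall hF0),
    lintegral_prod _ hFi.aestronglyMeasurable.aemeasurable.ennreal_ofReal]
  congr 1
  have hP := measurable_modProfile hm g
  have hJ : Measurable fun σ => ENNReal.ofReal (jap σ) := by
    have := continuous_jap.measurable
    fun_prop
  have hprod : Measurable (Function.uncurry fun ξ σ =>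
      (ENNReal.ofReal (jap σ) * modProfile m (fun x t => g (x, t)) ξ σ) ^ 2) :=
    ((hJ.comp measurable_snd).mul hP).pow_const 2
  calc ∫⁻ ξ, ∫⁻ τ, ENNReal.ofReal (F (ξ, τ))
      = ∫⁻ ξ, ∫⁻ σ, (ENNReal.ofReal (jap σ) * modProfile m (fun x t => g (x, t)) ξ σ) ^ 2 := by
        refine lintegral_congr fun ξ => ?_
        rw [← lintegral_add_left_eq_self (fun τ => ENNReal.ofReal (F (ξ, τ))) (ξ ^ 2)]
        refine lintegral_congr fun σ => ?_
        have h0 := (hm.pos hN ξ).le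
        have h1 := (jap_pos ξ).le
        have h2 := (jap_pos σ).le
        simp only [hF, modProfile, add_sub_cancel_left]
        rw [ENNReal.ofReal_mul (by positivity), ENNReal.ofReal_mul (by positivity),
          ENNReal.ofReal_pow (by positivity), ENNReal.ofReal_pow h2,
          ENNReal.ofReal_pow (norm_nonneg _), ofReal_norm]
        ring
    _ = ∫⁻ σ, ∫⁻ ξ, (ENNReal.ofReal (jap σ) * modProfile m (fun x t => g (x, t)) ξ σ) ^ 2 :=
        lintegral_lintegral_swap hprod.aemeasurable
    _ = _ := by
        refine lintegral_congr fun σ => ?_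
        simp_rw [mul_pow]
        have hσ : Measurable fun ξ => modProfile m (fun x t => g (x, t)) ξ σ :=
          hP.comp measurable_prodMk_right
        rw [lintegral_const_mul _ (hσ.pow_const 2), eL2, ← ENNReal.rpow_natCast,
          ← ENNReal.rpow_natCast, ← ENNReal.rpow_mul]
        norm_num

lemma measurable_eL2_modProfile (hm : AdmissibleLow N s m)
    (g : 𝓢(ℝ × ℝ, ℂ)) :
    Measurable fun σ => eL2 fun ξ => modProfile m (fun x t => g (x, t)) ξ σ := by
  unfold eL2
  exact (Measurable.lintegral_prod_left' ((measurable_modProfile hm g).pow_const 2)).pow_const _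

lemma lintegral_eL2_modProfile_le (hm : AdmissibleLow N s m) (hN : 0 ≤ N)
    (g : 𝓢(ℝ × ℝ, ℂ)) :
    ∫⁻ σ, eL2 (fun ξ => modProfile m (fun x t => g (x, t)) ξ σ) ≤ japInvNorm *
      ENNReal.ofReal (XsbNorm 1 (1 / 2 + 1 / 2) (multX m fun x t => g (x, t))) := by
  have hJ : Measurable fun σ => ENNReal.ofReal (jap σ) := by
    have := continuous_jap.measurable
    fun_prop
  rw [ofReal_XsbNorm_multX hm hN g, japInvNorm]
  refine le_trans (le_of_eq ?_) (lintegral_mul_le_sqrt_mul_sqrt volume hJ.inv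
    (hJ.mul (measurable_eL2_modProfile hm g)))
  refine lintegral_congr fun σ => ?_
  rw [← mul_assoc, ENNReal.inv_mul_cancel, one_mul]
  · exact (ENNReal.ofReal_pos.2 (jap_pos σ)).ne'
  · exact ENNReal.ofReal_ne_top

end WeightedNorm

/-- An oscillatory integral over a time interval of length at most one is bounded by the time
kernel. -/
lemma enorm_intervalIntegral_cexp_le {t₀ δ : ℝ} (hδ : 0 < δ) (hδ1 : δ ≤ 1) (ω : ℝ) :
    ‖∫ t in t₀..(t₀ + δ), Complex.exp (Complex.I * t * ω)‖ₑ ≤ timeKernel ω := by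
  rw [timeKernel, ← ofReal_norm]
  refine ENNReal.ofReal_le_ofReal ?_
  have hnorm : ∀ t : ℝ, ‖Complex.exp (Complex.I * t * ω)‖ = 1 := fun t => by
    rw [Complex.norm_exp]; simp
  have h1 : ‖∫ t in t₀..(t₀ + δ), Complex.exp (Complex.I * t * ω)‖ ≤ 1 := by
    refine (intervalIntegral.norm_integral_le_of_norm_le_const
      (fun t _ => (hnorm t).le)).trans ?_
    rw [add_sub_cancel_left, abs_of_pos hδ]
    linarith
  have h2 : |ω| * ‖∫ t in t₀..(t₀ + δ), Complex.exp (Complex.I * t * ω)‖ ≤ 2 := by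
    rcases eq_or_ne ω 0 with rfl | hω
    · simp
    have hc : Complex.I * ω ≠ 0 := mul_ne_zero Complex.I_ne_zero (by exact_mod_cast hω)
    have he : ∀ t : ℝ, Complex.I * ω * t = Complex.I * t * ω := fun t => by ring
    have hI := integral_exp_mul_complex (a := t₀) (b := t₀ + δ) hc
    simp only [he] at hI
    rw [hI, norm_div, norm_mul, Complex.norm_I, one_mul, Complex.norm_real, Real.norm_eq_abs,
      mul_div_cancel₀ _ (abs_ne_zero.2 hω)]
    refine (norm_sub_le _ _).trans ?_
    rw [hnorm, hnorm]
    norm_num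
  rw [le_div_iff₀ (by positivity)]
  linarith

lemma enorm_integral_oscillatory_le {X : Type*} [MeasurableSpace X] {μ : Measure X} [SFinite μ]
    {Φ : X → ℂ} (hΦ : Integrable Φ μ) {θ : X → ℝ} (hθ : Measurable θ) {t₀ δ : ℝ} (hδ : 0 < δ)
    (hδ1 : δ ≤ 1) :
    ‖∫ t in t₀..(t₀ + δ), ∫ x, Complex.exp (Complex.I * t * θ x) * Φ x ∂μ‖ₑ
      ≤ ∫⁻ x, timeKernel (θ x) * ‖Φ x‖ₑ ∂μ := by
  have : IsFiniteMeasure (volume.restrict (Set.uIoc t₀ (t₀ + δ))) := by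
    rw [Set.uIoc]
    infer_instance
  have hint : Integrable (Function.uncurry fun (t : ℝ) x =>
      Complex.exp (Complex.I * t * θ x) * Φ x)
      ((volume.restrict (Set.uIoc t₀ (t₀ + δ))).prod μ) := by
    have h1 : Integrable (fun z : ℝ × X => Φ z.2)
        ((volume.restrict (Set.uIoc t₀ (t₀ + δ))).prod μ) := by
      simpa using (integrable_const (1 : ℂ)).mul_prod hΦ
    refine h1.bdd_mul (c := 1) ?_ (.of_forall fun z => ?_)
    · have : Measurable fun z : ℝ × X => Complex.exp (Complex.I * z.1 * θ z.2) := by fun_prop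
      exact this.aestronglyMeasurable
    · rw [Complex.norm_exp]; simp
  rw [intervalIntegral_integral_swap hint]
  refine (enorm_integral_le_lintegral_enorm _).trans (lintegral_mono fun x => ?_)
  rw [intervalIntegral.integral_mul_const, enorm_mul]
  gcongr
  exact enorm_intervalIntegral_cexp_le hδ hδ1 (θ x)

section QuadrilinearForm

open SchwartzMap

/-- The normalised spacetime Fourier transform, recentred on the parabola. -/
def recentred (g : 𝓢(ℝ × ℝ, ℂ)) (η σ : ℝ) : ℂ :=
  (2 * π)⁻¹ • stft (fun x t => g (x, t)) η (η ^ 2 + σ)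

lemma continuous_recentred (g : 𝓢(ℝ × ℝ, ℂ)) {X : Type*} [TopologicalSpace X] {a b : X → ℝ}
    (ha : Continuous a) (hb : Continuous b) : Continuous fun z => recentred g (a z) (b z) := by
  unfold recentred
  have h := (continuous_stft g).comp (ha.prodMk ((ha.pow 2).add hb))
  exact h.const_smul ((2 * π)⁻¹)

lemma exists_recentred_bound (g : 𝓢(ℝ × ℝ, ℂ)) :
    ∃ K : ℝ, 0 ≤ K ∧ ∀ η σ : ℝ, ‖recentred g η σ‖ ≤ K * ((1 + η ^ 2)⁻¹ * (1 + σ ^ 2)⁻¹) := by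
  obtain ⟨K, hK0, hK⟩ := exists_stft_bound g
  refine ⟨(2 * π)⁻¹ * (K * 2), by positivity, fun η σ => ?_⟩
  rw [recentred, norm_smul, Real.norm_of_nonneg (by positivity), mul_assoc, mul_assoc]
  gcongr
  refine (hK _ _).trans (mul_le_mul_of_nonneg_left ?_ hK0)
  set A := 1 + η ^ 2 with hA
  set B := 1 + (η ^ 2 + σ) ^ 2 with hB
  have hA1 : 1 ≤ A := by nlinarith
  have hB1 : 1 ≤ B := by nlinarith
  have hpeetre : 1 + σ ^ 2 ≤ 2 * (B * A ^ 2) := by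
    have h1 : 1 + σ ^ 2 ≤ 2 * (B + η ^ 4) := by nlinarith [sq_nonneg (2 * η ^ 2 + σ)]
    have h2 : η ^ 4 ≤ A ^ 2 - 1 := by nlinarith [sq_nonneg η]
    nlinarith [mul_nonneg (sub_nonneg.2 hB1) (by nlinarith : (0 : ℝ) ≤ A ^ 2 - 1)]
  calc A⁻¹ ^ 5 * B⁻¹ ^ 2 ≤ A⁻¹ ^ 3 * B⁻¹ ^ 1 := by
        gcongr ?_ * ?_
        · exact pow_le_pow_of_le_one (by positivity) (inv_le_one_of_one_le₀ hA1) (by norm_num)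
        · exact pow_le_pow_of_le_one (by positivity) (inv_le_one_of_one_le₀ hB1) (by norm_num)
    _ = A⁻¹ * (B * A ^ 2)⁻¹ := by
        field_simp
    _ ≤ A⁻¹ * (2 * (1 + σ ^ 2)⁻¹) := by
        gcongr
        rw [← div_eq_mul_inv, le_div_iff₀ (by positivity), ← div_eq_inv_mul,
          div_le_iff₀ (by positivity)]
        exact hpeetre
    _ = 2 * (A⁻¹ * (1 + σ ^ 2)⁻¹) := by ring

lemma ft_timeSlice_eq_integral_recentred (g : 𝓢(ℝ × ℝ, ℂ)) (η t : ℝ) :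
    ft (fun x => g (x, t)) η =
      ∫ σ : ℝ, Complex.exp (Complex.I * t * (η ^ 2 + σ : ℝ)) * recentred g η σ := by
  rw [ft_timeSlice_eq_integral_stft, ← integral_add_left_eq_self _ (η ^ 2), ← integral_smul]
  refine integral_congr_ae (.of_forall fun σ => ?_)
  simp only [recentred, Complex.real_smul]
  ring

lemma ft_cj (f : ℝ → ℂ) (ξ : ℝ) : ft (cj f) ξ = (starRingEnd ℂ) (ft f (-ξ)) := by
  rw [ft, ft, ← integral_conj]
  refine integral_congr_ae (.of_forall fun x => ?_)
  simp only [cj, map_mul, ← Complex.exp_conj]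
  simp

lemma ft_cj_timeSlice_eq_integral_recentred (g : 𝓢(ℝ × ℝ, ℂ)) (η t : ℝ) :
    ft (cj fun x => g (x, t)) (-η) =
      ∫ σ : ℝ, Complex.exp (Complex.I * t * (-(η ^ 2 + σ) : ℝ))
        * (starRingEnd ℂ) (recentred g η σ) := by
  rw [ft_cj, neg_neg, ft_timeSlice_eq_integral_recentred, ← integral_conj]
  refine integral_congr_ae (.of_forall fun σ => ?_)
  simp only [map_mul, ← Complex.exp_conj, Complex.conj_I, Complex.conj_ofReal]
  congr 2
  push_cast
  ring

lemma integral_mul_four (a b c d : ℝ → ℂ) :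
    ∫ z : ℝ × ℝ × ℝ × ℝ, a z.1 * (b z.2.1 * (c z.2.2.1 * d z.2.2.2))
      = (∫ x, a x) * ((∫ x, b x) * ((∫ x, c x) * ∫ x, d x)) := by
  rw [← integral_prod_mul c d,
    ← integral_prod_mul b (fun z : ℝ × ℝ => c z.1 * d z.2),
    ← integral_prod_mul a (fun z : ℝ × ℝ × ℝ => b z.1 * (c z.2.1 * d z.2.2))]
  rfl

lemma lintegral_mul_four {a b c d : ℝ → ℝ≥0∞} (ha : Measurable a) (hb : Measurable b)
    (hc : Measurable c) (hd : Measurable d) :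
    ∫⁻ z : ℝ × ℝ × ℝ × ℝ, a z.1 * (b z.2.1 * (c z.2.2.1 * d z.2.2.2))
      = (∫⁻ x, a x) * ((∫⁻ x, b x) * ((∫⁻ x, c x) * ∫⁻ x, d x)) := by
  rw [← lintegral_prod_mul hc.aemeasurable hd.aemeasurable,
    ← lintegral_prod_mul hb.aemeasurable (g := fun z : ℝ × ℝ => c z.1 * d z.2)
      (by fun_prop),
    ← lintegral_prod_mul ha.aemeasurable (g := fun z : ℝ × ℝ × ℝ => b z.1 * (c z.2.1 * d z.2.2))
      (by fun_prop)]
  rfl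

lemma integral_prod_three {H : ℝ × ℝ × ℝ → ℂ} (hH : Integrable H) :
    ∫ z, H z = ∫ x, ∫ y, ∫ w, H (x, y, w) := by
  rw [Measure.volume_eq_prod] at hH ⊢
  rw [integral_prod _ hH]
  refine integral_congr_ae ?_
  filter_upwards [hH.prod_right_ae] with x hx
  exact integral_prod _ hx

/-- The phase of the quadrilinear form. -/
def quadPhase (z : (ℝ × ℝ × ℝ) × ℝ × ℝ × ℝ × ℝ) : ℝ :=
  (z.1.1 ^ 2 + z.2.1) + (-((-z.1.2.1) ^ 2 + z.2.2.1) + ((z.1.2.2 ^ 2 + z.2.2.2.1)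
    + -((z.1.1 + z.1.2.1 + z.1.2.2) ^ 2 + z.2.2.2.2)))

/-- The amplitude of the quadrilinear form. -/
def quadAmplitude (M : ℝ → ℝ → ℝ → ℝ → ℝ) (g₁ g₂ g₃ g₄ : 𝓢(ℝ × ℝ, ℂ))
    (z : (ℝ × ℝ × ℝ) × ℝ × ℝ × ℝ × ℝ) : ℂ :=
  (M z.1.1 z.1.2.1 z.1.2.2 (-(z.1.1 + z.1.2.1 + z.1.2.2)) : ℂ) *
    (recentred g₁ z.1.1 z.2.1 * ((starRingEnd ℂ) (recentred g₂ (-z.1.2.1) z.2.2.1) *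
      (recentred g₃ z.1.2.2 z.2.2.2.1 *
        (starRingEnd ℂ) (recentred g₄ (z.1.1 + z.1.2.1 + z.1.2.2) z.2.2.2.2))))

lemma measurable_quadPhase : Measurable quadPhase := by
  unfold quadPhase
  fun_prop

lemma continuous_quadAmplitude {M : ℝ → ℝ → ℝ → ℝ → ℝ}
    (hM : Continuous fun z : ℝ × ℝ × ℝ × ℝ => M z.1 z.2.1 z.2.2.1 z.2.2.2)
    (g₁ g₂ g₃ g₄ : 𝓢(ℝ × ℝ, ℂ)) : Continuous (quadAmplitude M g₁ g₂ g₃ g₄) := by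
  have hM' : Continuous fun z : (ℝ × ℝ × ℝ) × ℝ × ℝ × ℝ × ℝ =>
      M z.1.1 z.1.2.1 z.1.2.2 (-(z.1.1 + z.1.2.1 + z.1.2.2)) :=
    hM.comp (by fun_prop : Continuous fun z : (ℝ × ℝ × ℝ) × ℝ × ℝ × ℝ × ℝ =>
      (z.1.1, z.1.2.1, z.1.2.2, -(z.1.1 + z.1.2.1 + z.1.2.2)))
  unfold quadAmplitude
  refine (Complex.continuous_ofReal.comp hM').mul
    ((continuous_recentred g₁ (by fun_prop) (by fun_prop)).mul
    ((Complex.continuous_conj.comp (continuous_recentred g₂ (by fun_prop) (by fun_prop))).mul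
    ((continuous_recentred g₃ (by fun_prop) (by fun_prop)).mul
    (Complex.continuous_conj.comp (continuous_recentred g₄ (by fun_prop) (by fun_prop))))))

lemma integrable_quadAmplitude {M : ℝ → ℝ → ℝ → ℝ → ℝ}
    (hM : Continuous fun z : ℝ × ℝ × ℝ × ℝ => M z.1 z.2.1 z.2.2.1 z.2.2.2) {B : ℝ}
    (hB : ∀ ξ₁ ξ₂ ξ₃ ξ₄, |M ξ₁ ξ₂ ξ₃ ξ₄| ≤ B) (g₁ g₂ g₃ g₄ : 𝓢(ℝ × ℝ, ℂ)) :
    Integrable (quadAmplitude M g₁ g₂ g₃ g₄) := by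
  obtain ⟨K₁, hK₁, h₁⟩ := exists_recentred_bound g₁
  obtain ⟨K₂, hK₂, h₂⟩ := exists_recentred_bound g₂
  obtain ⟨K₃, hK₃, h₃⟩ := exists_recentred_bound g₃
  obtain ⟨K₄, hK₄, h₄⟩ := exists_recentred_bound g₄
  have hJ := integrable_inv_one_add_sq
  have hJ4 : Integrable fun z : ℝ × ℝ × ℝ × ℝ => (1 + z.1 ^ 2)⁻¹ * ((1 + z.2.1 ^ 2)⁻¹ *
      ((1 + z.2.2.1 ^ 2)⁻¹ * (1 + z.2.2.2 ^ 2)⁻¹)) :=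
    hJ.mul_prod (hJ.mul_prod (hJ.mul_prod hJ))
  have hJ3 : Integrable fun z : ℝ × ℝ × ℝ => (1 + z.1 ^ 2)⁻¹ * ((1 + z.2.1 ^ 2)⁻¹ *
      (1 + z.2.2 ^ 2)⁻¹) := hJ.mul_prod (hJ.mul_prod hJ)
  refine ((hJ3.mul_prod hJ4).const_mul (B * (K₁ * (K₂ * (K₃ * K₄))))).mono'
    (continuous_quadAmplitude hM g₁ g₂ g₃ g₄).aestronglyMeasurable (.of_forall ?_)
  rintro ⟨⟨ξ₁, ξ₂, ξ₃⟩, σ₁, σ₂, σ₃, σ₄⟩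
  have hB0 : 0 ≤ B := (abs_nonneg _).trans (hB 0 0 0 0)
  simp only [quadAmplitude, norm_mul, RCLike.norm_conj, Complex.norm_real, Real.norm_eq_abs]
  have h₄' : ‖recentred g₄ (ξ₁ + ξ₂ + ξ₃) σ₄‖ ≤ K₄ * (1 * (1 + σ₄ ^ 2)⁻¹) := by
    refine (h₄ _ _).trans ?_
    gcongr
    exact inv_le_one_of_one_le₀ (by nlinarith)
  have h₂' : ‖recentred g₂ (-ξ₂) σ₂‖ ≤ K₂ * ((1 + ξ₂ ^ 2)⁻¹ * (1 + σ₂ ^ 2)⁻¹) := by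
    simpa only [neg_sq] using h₂ (-ξ₂) σ₂
  calc _ ≤ B * ((K₁ * ((1 + ξ₁ ^ 2)⁻¹ * (1 + σ₁ ^ 2)⁻¹))
        * ((K₂ * ((1 + ξ₂ ^ 2)⁻¹ * (1 + σ₂ ^ 2)⁻¹)) * ((K₃ * ((1 + ξ₃ ^ 2)⁻¹ * (1 + σ₃ ^ 2)⁻¹))
          * (K₄ * (1 * (1 + σ₄ ^ 2)⁻¹))))) := by
        gcongr
        · exact hB _ _ _ _
        · exact h₁ _ _
        · exact h₃ _ _
    _ = _ := by ring

/-- The quadrilinear form at a fixed time as an oscillatory integral. -/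
lemma Lam4_eq_integral {M : ℝ → ℝ → ℝ → ℝ → ℝ}
    (hM : Continuous fun z : ℝ × ℝ × ℝ × ℝ => M z.1 z.2.1 z.2.2.1 z.2.2.2) {B : ℝ}
    (hB : ∀ ξ₁ ξ₂ ξ₃ ξ₄, |M ξ₁ ξ₂ ξ₃ ξ₄| ≤ B) (g₁ g₂ g₃ g₄ : 𝓢(ℝ × ℝ, ℂ)) (t : ℝ) :
    Lam4 M (fun x => g₁ (x, t)) (cj fun x => g₂ (x, t)) (fun x => g₃ (x, t))
        (cj fun x => g₄ (x, t))
      = ∫ z, Complex.exp (Complex.I * t * quadPhase z) * quadAmplitude M g₁ g₂ g₃ g₄ z := by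
  have hint : Integrable fun z =>
      Complex.exp (Complex.I * t * quadPhase z) * quadAmplitude M g₁ g₂ g₃ g₄ z := by
    refine (integrable_quadAmplitude hM hB g₁ g₂ g₃ g₄).bdd_mul (c := 1) ?_
      (.of_forall fun z => ?_)
    · have := measurable_quadPhase
      exact Measurable.aestronglyMeasurable (by fun_prop)
    · rw [Complex.norm_exp]; simp
  rw [Measure.volume_eq_prod] at hint ⊢
  rw [integral_prod _ hint, integral_prod_three hint.integral_prod_left, Lam4]
  refine integral_congr_ae (.of_forall fun ξ₁ => integral_congr_ae (.of_forall fun ξ₂ =>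
    integral_congr_ae (.of_forall fun ξ₃ => ?_)))
  have h₂ := ft_cj_timeSlice_eq_integral_recentred g₂ (-ξ₂) t
  rw [neg_neg] at h₂
  simp only
  rw [ft_timeSlice_eq_integral_recentred, h₂, ft_timeSlice_eq_integral_recentred,
    ft_cj_timeSlice_eq_integral_recentred]
  simp only [mul_assoc]
  rw [← integral_mul_four, ← integral_const_mul]
  refine integral_congr_ae (.of_forall fun σ => ?_)
  simp only [quadPhase, quadAmplitude, Complex.ofReal_add, mul_add, Complex.exp_add]
  ring

end QuadrilinearForm

section Conclusion

open SchwartzMap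

lemma lintegral_parallelogram_coordinates {h : ℝ × ℝ × ℝ → ℝ≥0∞} (hh : Measurable h) :
    ∫⁻ z, h z = ∫⁻ p, ∫⁻ q, ∫⁻ x, h (x, p - x, x - p - q) := by
  have h1 : Measurable (Function.uncurry fun x p => ∫⁻ q, h (x, p - x, x - p - q)) := by
    refine Measurable.lintegral_prod_right' (f := fun z : (ℝ × ℝ) × ℝ =>
      h (z.1.1, z.1.2 - z.1.1, z.1.1 - z.1.2 - z.2)) ?_
    fun_prop
  rw [Measure.volume_eq_prod, lintegral_prod _ hh.aemeasurable]
  calc ∫⁻ x, ∫⁻ y : ℝ × ℝ, h (x, y)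
      = ∫⁻ x, ∫⁻ p, ∫⁻ q, h (x, p - x, x - p - q) := by
        refine lintegral_congr fun x => ?_
        have hx : Measurable fun y => h (x, y) := hh.comp measurable_prodMk_left
        rw [Measure.volume_eq_prod, lintegral_prod _ hx.aemeasurable,
          ← lintegral_sub_right_eq_self _ x]
        refine lintegral_congr fun p => ?_
        rw [← lintegral_sub_left_eq_self _ (x - p)]
    _ = ∫⁻ p, ∫⁻ x, ∫⁻ q, h (x, p - x, x - p - q) := lintegral_lintegral_swap h1.aemeasurable
    _ = _ := by
        refine lintegral_congr fun p => lintegral_lintegral_swap ?_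
        exact Measurable.aemeasurable (by fun_prop)

variable {m : ℝ → ℝ} {N s : ℝ}

/-- The symbol of the quadrilinear form. -/
def alternatingSq (m : ℝ → ℝ) (ξ₁ ξ₂ ξ₃ ξ₄ : ℝ) : ℝ := m ξ₁ ^ 2 - m ξ₂ ^ 2 + m ξ₃ ^ 2 - m ξ₄ ^ 2

lemma continuous_alternatingSq (hm : AdmissibleLow N s m) :
    Continuous fun z : ℝ × ℝ × ℝ × ℝ => alternatingSq m z.1 z.2.1 z.2.2.1 z.2.2.2 := by
  have := hm.smooth.continuous
  unfold alternatingSq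
  fun_prop

lemma abs_alternatingSq_le_two (hm : AdmissibleLow N s m) (hN : 0 ≤ N) (ξ₁ ξ₂ ξ₃ ξ₄ : ℝ) :
    |alternatingSq m ξ₁ ξ₂ ξ₃ ξ₄| ≤ 2 := by
  have h : ∀ ξ, 0 ≤ m ξ ^ 2 ∧ m ξ ^ 2 ≤ 1 := fun ξ =>
    ⟨sq_nonneg _, pow_le_one₀ (hm.pos hN ξ).le (hm.le_one hN ξ)⟩
  rw [alternatingSq, abs_le]
  constructor <;> linarith [h ξ₁, h ξ₂, h ξ₃, h ξ₄]

lemma enorm_recentred_le (g : 𝓢(ℝ × ℝ, ℂ)) (η σ : ℝ) :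
    ‖recentred g η σ‖ₑ ≤ ‖stft (fun x t => g (x, t)) η (η ^ 2 + σ)‖ₑ := by
  rw [recentred, ← ofReal_norm, ← ofReal_norm, norm_smul]
  refine ENNReal.ofReal_le_ofReal (mul_le_of_le_one_left (norm_nonneg _) ?_)
  rw [Real.norm_of_nonneg (by positivity)]
  exact inv_le_one_of_one_le₀ (by linarith [pi_gt_three])

lemma enorm_quadAmplitude_le (hm : AdmissibleLow N s m) (hN : 0 < N) (g₁ g₂ g₃ g₄ : 𝓢(ℝ × ℝ, ℂ))
    (x p q σ₁ σ₂ σ₃ σ₄ : ℝ) :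
    ‖quadAmplitude (alternatingSq m) g₁ g₂ g₃ g₄ ((x, p - x, x - p - q), σ₁, σ₂, σ₃, σ₄)‖ₑ
      ≤ ENNReal.ofReal (18 / N ^ 2) * (modProfile m (fun x t => g₁ (x, t)) x σ₁
        * modProfile m (fun x t => g₂ (x, t)) (x - p) σ₂
        * modProfile m (fun x t => g₃ (x, t)) (x - p - q) σ₃
        * modProfile m (fun x t => g₄ (x, t)) (x - q) σ₄) := by
  have e2 : -(p - x) = x - p := by ring
  have e4 : x + (p - x) + (x - p - q) = x - q := by ring
  have hw : ∀ ξ, 0 ≤ m ξ * jap ξ := fun ξ => mul_nonneg (hm.pos hN.le ξ).le (jap_pos ξ).le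
  have hweven : ∀ ξ, m (-ξ) * jap (-ξ) = m ξ * jap ξ := fun ξ => by rw [hm.even, jap_neg]
  have hM := hm.abs_alternating_sq_le hN
    (show x + (p - x) + (x - p - q) + -(x - q) = 0 by ring)
  rw [hweven, ← hweven (p - x), e2] at hM
  have hMe : ‖((alternatingSq m x (p - x) (x - p - q) (-(x - q)) : ℝ) : ℂ)‖ₑ
      ≤ ENNReal.ofReal (18 / N ^ 2) * (ENNReal.ofReal (m x * jap x)
        * ENNReal.ofReal (m (x - p) * jap (x - p))
        * ENNReal.ofReal (m (x - p - q) * jap (x - p - q))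
        * ENNReal.ofReal (m (x - q) * jap (x - q))) := by
    rw [← ofReal_norm, Complex.norm_real, Real.norm_eq_abs]
    refine (ENNReal.ofReal_le_ofReal hM).trans_eq ?_
    have := hw x
    have := hw (x - p)
    have := hw (x - p - q)
    rw [ENNReal.ofReal_mul (by positivity), ENNReal.ofReal_mul (by positivity),
      ENNReal.ofReal_mul (by positivity), ENNReal.ofReal_mul (by positivity)]
  simp only [quadAmplitude, e2, e4, enorm_mul, RCLike.enorm_conj, modProfile]
  calc _ ≤ (ENNReal.ofReal (18 / N ^ 2) * (ENNReal.ofReal (m x * jap x)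
        * ENNReal.ofReal (m (x - p) * jap (x - p))
        * ENNReal.ofReal (m (x - p - q) * jap (x - p - q))
        * ENNReal.ofReal (m (x - q) * jap (x - q)))) * (_ * (_ * (_ * _))) :=
        mul_le_mul' hMe (mul_le_mul' (enorm_recentred_le g₁ _ _)
          (mul_le_mul' (enorm_recentred_le g₂ _ _)
            (mul_le_mul' (enorm_recentred_le g₃ _ _) (enorm_recentred_le g₄ _ _))))
    _ = _ := by ring

lemma lintegral_quadAmplitude_le {C : ℝ≥0∞}
    (hC : ∀ a : ℝ, ∫⁻ r, timeKernel (2 * r + a) * ENNReal.ofReal (|r| ^ (-(1 / 2) : ℝ)) ≤ C)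
    (hm : AdmissibleLow N s m) (hN : 0 < N) (g₁ g₂ g₃ g₄ : 𝓢(ℝ × ℝ, ℂ)) :
    ∫⁻ z, timeKernel (quadPhase z) * ‖quadAmplitude (alternatingSq m) g₁ g₂ g₃ g₄ z‖ₑ
      ≤ ENNReal.ofReal (18 / N ^ 2) * (2 * C) * japInvNorm ^ 4
        * (ENNReal.ofReal (XsbNorm 1 (1 / 2 + 1 / 2) (multX m fun x t => g₁ (x, t)))
          * ENNReal.ofReal (XsbNorm 1 (1 / 2 + 1 / 2) (multX m fun x t => g₂ (x, t)))
          * ENNReal.ofReal (XsbNorm 1 (1 / 2 + 1 / 2) (multX m fun x t => g₃ (x, t)))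
          * ENNReal.ofReal (XsbNorm 1 (1 / 2 + 1 / 2) (multX m fun x t => g₄ (x, t)))) := by
  set G : (ℝ × ℝ × ℝ) × ℝ × ℝ × ℝ × ℝ → ℝ≥0∞ := fun z =>
    timeKernel (quadPhase z) * ‖quadAmplitude (alternatingSq m) g₁ g₂ g₃ g₄ z‖ₑ with hG
  have hGm : Measurable G := (measurable_timeKernel.comp measurable_quadPhase).mul
    (continuous_quadAmplitude (continuous_alternatingSq hm) g₁ g₂ g₃ g₄).enorm.measurable
  set P : 𝓢(ℝ × ℝ, ℂ) → ℝ → ℝ → ℝ≥0∞ := fun g ξ σ => modProfile m (fun x t => g (x, t)) ξ σ with hP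
  have hPm : ∀ g σ, Measurable fun ξ => P g ξ σ := fun g σ =>
    (measurable_modProfile hm g).comp measurable_prodMk_right
  have hE : ∀ g, Measurable fun σ => eL2 fun ξ => P g ξ σ := measurable_eL2_modProfile hm
  rw [Measure.volume_eq_prod, lintegral_prod_symm _ hGm.aemeasurable]
  calc ∫⁻ σ : ℝ × ℝ × ℝ × ℝ, ∫⁻ ξ, G (ξ, σ)
      ≤ ∫⁻ σ : ℝ × ℝ × ℝ × ℝ, ENNReal.ofReal (18 / N ^ 2) * (2 * C) *
          ((eL2 fun ξ => P g₁ ξ σ.1) * ((eL2 fun ξ => P g₂ ξ σ.2.1) *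
          ((eL2 fun ξ => P g₃ ξ σ.2.2.1) * eL2 fun ξ => P g₄ ξ σ.2.2.2))) := by
        refine lintegral_mono fun σ => ?_
        obtain ⟨σ₁, σ₂, σ₃, σ₄⟩ := σ
        have hGσ : Measurable fun ξ => G (ξ, σ₁, σ₂, σ₃, σ₄) := hGm.comp measurable_prodMk_right
        rw [lintegral_parallelogram_coordinates hGσ]
        have hpar := timeKernel_parallelogram_le hC (hPm g₁ σ₁) (hPm g₂ σ₂) (hPm g₃ σ₃)
          (hPm g₄ σ₄) (σ₁ - σ₂ + σ₃ - σ₄)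
        calc ∫⁻ p, ∫⁻ q, ∫⁻ x, G ((x, p - x, x - p - q), σ₁, σ₂, σ₃, σ₄)
            ≤ ∫⁻ p, ∫⁻ q, ENNReal.ofReal (18 / N ^ 2) *
                (timeKernel (2 * (p * q) + (σ₁ - σ₂ + σ₃ - σ₄)) * parallelogram
                  (fun ξ => P g₁ ξ σ₁) (fun ξ => P g₂ ξ σ₂) (fun ξ => P g₃ ξ σ₃)
                  (fun ξ => P g₄ ξ σ₄) p q) := by
              refine lintegral_mono fun p => lintegral_mono fun q => ?_
              have hmeas : Measurable fun x =>
                  P g₁ x σ₁ * P g₂ (x - p) σ₂ * P g₃ (x - p - q) σ₃ * P g₄ (x - q) σ₄ := by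
                have h₁ := hPm g₁ σ₁
                have h₂ := (hPm g₂ σ₂).comp (measurable_id.sub_const p)
                have h₃ := (hPm g₃ σ₃).comp ((measurable_id.sub_const p).sub_const q)
                have h₄ := (hPm g₄ σ₄).comp (measurable_id.sub_const q)
                exact ((h₁.mul h₂).mul h₃).mul h₄
              rw [parallelogram, ← lintegral_const_mul _ hmeas,
                ← lintegral_const_mul _ (hmeas.const_mul _)]
              refine lintegral_mono fun x => ?_
              have hphase : quadPhase ((x, p - x, x - p - q), σ₁, σ₂, σ₃, σ₄)
                  = 2 * (p * q) + (σ₁ - σ₂ + σ₃ - σ₄) := by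
                simp only [quadPhase]
                ring
              simp only [hG, hphase]
              refine (mul_le_mul_right
                (enorm_quadAmplitude_le hm hN g₁ g₂ g₃ g₄ x p q σ₁ σ₂ σ₃ σ₄) _).trans_eq ?_
              ring
          _ = ENNReal.ofReal (18 / N ^ 2) * ∫⁻ p, ∫⁻ q,
                timeKernel (2 * (p * q) + (σ₁ - σ₂ + σ₃ - σ₄)) * parallelogram
                  (fun ξ => P g₁ ξ σ₁) (fun ξ => P g₂ ξ σ₂) (fun ξ => P g₃ ξ σ₃)
                  (fun ξ => P g₄ ξ σ₄) p q := by
              simp_rw [lintegral_const_mul' _ _ ENNReal.ofReal_ne_top]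
          _ ≤ ENNReal.ofReal (18 / N ^ 2) * _ := mul_le_mul_right hpar _
          _ = _ := by ring
    _ = ENNReal.ofReal (18 / N ^ 2) * (2 * C) *
          ((∫⁻ σ, eL2 fun ξ => P g₁ ξ σ) * ((∫⁻ σ, eL2 fun ξ => P g₂ ξ σ) *
          ((∫⁻ σ, eL2 fun ξ => P g₃ ξ σ) * ∫⁻ σ, eL2 fun ξ => P g₄ ξ σ))) := by
        rw [← lintegral_mul_four (hE g₁) (hE g₂) (hE g₃) (hE g₄), ← lintegral_const_mul]
        have h₁ := hE g₁
        have h₂ := hE g₂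
        have h₃ := hE g₃
        have h₄ := hE g₄
        exact (h₁.comp measurable_fst).mul ((h₂.comp measurable_snd.fst).mul
          ((h₃.comp measurable_snd.snd.fst).mul (h₄.comp measurable_snd.snd.snd)))
    _ ≤ ENNReal.ofReal (18 / N ^ 2) * (2 * C) * (_ * (_ * (_ * _))) :=
        mul_le_mul_right (mul_le_mul' (lintegral_eL2_modProfile_le hm hN.le g₁)
          (mul_le_mul' (lintegral_eL2_modProfile_le hm hN.le g₂)
            (mul_le_mul' (lintegral_eL2_modProfile_le hm hN.le g₃)
              (lintegral_eL2_modProfile_le hm hN.le g₄)))) _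
    _ = _ := by ring

lemma XsbNorm_nonneg (s b : ℝ) (u : ℝ → ℝ → ℂ) : 0 ≤ XsbNorm s b u := by
  refine Real.rpow_nonneg (integral_nonneg fun ξ => integral_nonneg fun τ => ?_) _
  have h1 := Real.rpow_nonneg (jap_pos ξ).le (2 * s)
  have h2 := Real.rpow_nonneg (jap_pos (τ - ξ ^ 2)).le (2 * b)
  positivity

end Conclusion

/-- the `Λ₄` estimate with symbol `M₄''`. -/
theorem lambda4_Mdoubleprime_estimate
    (s ε : ℝ) (hs0 : 0 ≤ s) (hs1 : s < 1) (hε : 0 < ε) :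
    ∃ ε' C : ℝ, 0 < ε' ∧ 0 < C ∧
      ∀ N : ℝ, 2 ≤ N → ∀ m : ℝ → ℝ, AdmissibleLow N s m →
      ∀ t₀ δ : ℝ, 0 < δ → δ ≤ 1 →
      ∀ u₁ u₂ u₃ u₄ : ℝ → ℝ → ℂ,
      IsSchwartz2 u₁ → IsSchwartz2 u₂ → IsSchwartz2 u₃ → IsSchwartz2 u₄ →
      ‖(∫ t in t₀..(t₀ + δ),
          Lam4 (fun ξ₁ ξ₂ ξ₃ ξ₄ => m ξ₁ ^ 2 - m ξ₂ ^ 2 + m ξ₃ ^ 2 - m ξ₄ ^ 2)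
            (fun x => u₁ x t) (cj fun x => u₂ x t) (fun x => u₃ x t) (cj fun x => u₄ x t))‖
        ≤ C * N ^ (-1 + ε) * (XsbNorm 1 (1 / 2 + ε') (multX m u₁)
          * XsbNorm 1 (1 / 2 + ε') (multX m u₂) * XsbNorm 1 (1 / 2 + ε') (multX m u₃)
          * XsbNorm 1 (1 / 2 + ε') (multX m u₄)) := by
  obtain ⟨C, hCtop, hC⟩ := exists_timeKernel_weight_bound
  set c := C.toReal with hc
  set j := japInvNorm.toReal with hj
  have hc0 : 0 ≤ c := ENNReal.toReal_nonneg
  have hj0 : 0 ≤ j := ENNReal.toReal_nonneg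
  refine ⟨1 / 2, 18 * (2 * c) * j ^ 4 + 1, by norm_num, by positivity, ?_⟩
  intro N hN m hm t₀ δ hδ hδ1 u₁ u₂ u₃ u₄ hu₁ hu₂ hu₃ hu₄
  have hN0 : 0 < N := by linarith
  obtain ⟨g₁, hg₁⟩ := hu₁
  obtain ⟨g₂, hg₂⟩ := hu₂
  obtain ⟨g₃, hg₃⟩ := hu₃
  obtain ⟨g₄, hg₄⟩ := hu₄
  obtain rfl : u₁ = fun x t => g₁ (x, t) := funext₂ hg₁
  obtain rfl : u₂ = fun x t => g₂ (x, t) := funext₂ hg₂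
  obtain rfl : u₃ = fun x t => g₃ (x, t) := funext₂ hg₃
  obtain rfl : u₄ = fun x t => g₄ (x, t) := funext₂ hg₄
  have hcont := continuous_alternatingSq hm
  have hbound := abs_alternatingSq_le_two hm hN0.le
  have hrep : ∀ t : ℝ, Lam4 (fun ξ₁ ξ₂ ξ₃ ξ₄ => m ξ₁ ^ 2 - m ξ₂ ^ 2 + m ξ₃ ^ 2 - m ξ₄ ^ 2)
      (fun x => g₁ (x, t)) (cj fun x => g₂ (x, t)) (fun x => g₃ (x, t)) (cj fun x => g₄ (x, t))
      = _ := Lam4_eq_integral hcont hbound g₁ g₂ g₃ g₄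
  simp only [hrep]
  have hmain := (enorm_integral_oscillatory_le
    (integrable_quadAmplitude hcont hbound g₁ g₂ g₃ g₄) measurable_quadPhase
    (t₀ := t₀) hδ hδ1).trans (lintegral_quadAmplitude_le hC hm hN0 g₁ g₂ g₃ g₄)
  have hX₁ := XsbNorm_nonneg 1 (1 / 2 + 1 / 2) (multX m fun x t => g₁ (x, t))
  have hX₂ := XsbNorm_nonneg 1 (1 / 2 + 1 / 2) (multX m fun x t => g₂ (x, t))
  have hX₃ := XsbNorm_nonneg 1 (1 / 2 + 1 / 2) (multX m fun x t => g₃ (x, t))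
  have hX₄ := XsbNorm_nonneg 1 (1 / 2 + 1 / 2) (multX m fun x t => g₄ (x, t))
  set X₁ := XsbNorm 1 (1 / 2 + 1 / 2) (multX m fun x t => g₁ (x, t))
  set X₂ := XsbNorm 1 (1 / 2 + 1 / 2) (multX m fun x t => g₂ (x, t))
  set X₃ := XsbNorm 1 (1 / 2 + 1 / 2) (multX m fun x t => g₃ (x, t))
  set X₄ := XsbNorm 1 (1 / 2 + 1 / 2) (multX m fun x t => g₄ (x, t))
  rw [← ENNReal.ofReal_toReal hCtop, ← ENNReal.ofReal_toReal japInvNorm_ne_top, ← hc, ← hj,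
    ← ENNReal.ofReal_ofNat 2, ← ENNReal.ofReal_mul (by positivity),
    ← ENNReal.ofReal_mul (by positivity), ← ENNReal.ofReal_pow hj0,
    ← ENNReal.ofReal_mul (by positivity), ← ENNReal.ofReal_mul (by positivity),
    ← ENNReal.ofReal_mul (by positivity), ← ENNReal.ofReal_mul (by positivity),
    ← ENNReal.ofReal_mul (by positivity), ← ofReal_norm,
    ENNReal.ofReal_le_ofReal_iff (by positivity)] at hmain
  refine hmain.trans (mul_le_mul_of_nonneg_right ?_ (by positivity))
  have hpow : (N ^ 2)⁻¹ ≤ N ^ (-1 + ε) := by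
    rw [← Real.rpow_natCast, ← Real.rpow_neg hN0.le]
    refine Real.rpow_le_rpow_of_exponent_le (by linarith) ?_
    push_cast
    linarith
  calc 18 / N ^ 2 * (2 * c) * j ^ 4 = 18 * (2 * c) * j ^ 4 * (N ^ 2)⁻¹ := by ring
    _ ≤ (18 * (2 * c) * j ^ 4 + 1) * N ^ (-1 + ε) := by
        gcongr
        linarith
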